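/- Let q be a power of a prime p > 3 and let m = 2. Then the limit as k → ∞ of the fraction of Weierstrass pairs (A,B) of level k (in 3 variables) such that W_{A,B} is singular over no point P ∈ ℙ²(𝔽̄_q) exists and equals (1 − q^{-1})(1 − q^{-2})(1 − q^{-3}) = ζ_{ℙ²}(3)^{-1}. -/

import Mathlib

open MvPolynomial Filter

noncomputable section

variable (F : Type) [Field F] [Fintype F]

/-- The set of Weierstrass pairs `(A,B)` of level `k` in 3 variables: `A` homogeneous
of degree `4k` and `B` homogeneous of degree `6k`. -/
def WPairs (k : ℕ) : Set (MvPolynomial (Fin 3) F × MvPolynomial (Fin 3) F) :=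
  {AB | AB.1.IsHomogeneous (4 * k) ∧ AB.2.IsHomogeneous (6 * k)}

/-- The Weierstrass model `W_{A,B}` is singular at a point lying over the point of
`ℙ²(𝔽̄_q)` with homogeneous coordinates `pt`. -/
def SingAt (A B : MvPolynomial (Fin 3) F) (pt : Fin 3 → AlgebraicClosure F) : Prop :=
  ∃ x y : AlgebraicClosure F,
    y ^ 2 = x ^ 3 + aeval pt A * x + aeval pt B ∧
    2 * y = 0 ∧
    3 * x ^ 2 + aeval pt A = 0 ∧
    ∀ i, aeval pt (pderiv i A) * x + aeval pt (pderiv i B) = 0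

variable {F}

section Counting

theorem card_preimage_mul_card {V W : Type*} [AddCommGroup V] [AddCommGroup W] [Finite V]
    (f : V →+ W) (hf : Function.Surjective f) (T : Set W) :
    Nat.card (f ⁻¹' T) * Nat.card W = Nat.card T * Nat.card V := by
  classical
  have : Finite W := Finite.of_surjective f hf
  have key : ∀ w : W, Nonempty ({v : V // f v = w} ≃ f.ker) := by
    intro w
    obtain ⟨v₀, rfl⟩ := hf w
    exact ⟨{ toFun := fun v => ⟨v.1 - v₀, by simp [AddMonoidHom.mem_ker, v.2]⟩
             invFun := fun u => ⟨u.1 + v₀, by simp [AddMonoidHom.mem_ker.1 u.2]⟩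
             left_inv := fun v => by simp
             right_inv := fun u => by simp }⟩
  have h1 : ∀ T : Set W, Nat.card (f ⁻¹' T) = Nat.card T * Nat.card f.ker := by
    intro T
    rw [← Nat.card_prod]
    refine Nat.card_congr (Equiv.trans (Equiv.sigmaFiberEquiv
      (fun v : f ⁻¹' T => (⟨f v.1, v.2⟩ : T))).symm
      (Equiv.trans (Equiv.sigmaCongrRight fun w => ?_) (Equiv.sigmaEquivProd T f.ker)))
    refine Equiv.trans ?_ (key w.1).some
    exact { toFun := fun v => ⟨v.1.1, congrArg Subtype.val v.2⟩
            invFun := fun v => ⟨⟨v.1, by simp [v.2]⟩, Subtype.ext v.2⟩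
            left_inv := fun v => rfl
            right_inv := fun v => rfl }
  have h2 := h1 Set.univ
  rw [Set.preimage_univ, Nat.card_univ, Nat.card_univ] at h2
  rw [h1 T, h2]
  ring

theorem card_fiber_mul_le {V U R : Type*} [AddCommGroup V] [Finite V] [AddCommGroup R]
    (ψ : V →+ R) (ι : U → V) (hι : Function.Injective (fun u => ψ (ι u)))
    (T : Set V) (hT : ∀ g ∈ T, ∀ g' ∈ T, ψ g = ψ g') :
    Nat.card T * Nat.card U ≤ Nat.card V := by
  rw [← Nat.card_prod]
  refine Nat.card_le_card_of_injective (fun x : T × U => x.1.1 + ι x.2) ?_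
  rintro ⟨⟨t, ht⟩, u⟩ ⟨⟨t', ht'⟩, u'⟩ h
  simp only at h
  have h1 := congrArg ψ h
  rw [map_add, map_add, hT t ht t' ht'] at h1
  obtain rfl := hι (add_left_cancel h1)
  simpa using h

/-- In characteristic `p`, the condition `(u + g ^ p) ^ 2 = w` on an element `g` of a domain
has at most two solutions. -/
theorem card_square_fiber_mul_le {V U R : Type*} [AddCommGroup V] [Finite V] [CommRing R]
    [IsDomain R] (p : ℕ) [hp : Fact p.Prime] [CharP R p]
    (ψ : V →+ R) (ι : U → V) (hι : Function.Injective (fun u => ψ (ι u))) (u w : R) :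
    Nat.card {g : V | (u + ψ g ^ p) ^ 2 = w} * Nat.card U ≤ 2 * Nat.card V := by
  classical
  rcases Set.eq_empty_or_nonempty {g : V | (u + ψ g ^ p) ^ 2 = w} with h | ⟨g₀, h₀⟩
  · rw [h]; simp
  have frob : ∀ a b : R, a ^ p = b ^ p → a = b := fun a b h => frobenius_inj R p h
  set T₁ : Set V := {g | ψ g = ψ g₀}
  set T₂ : Set V := {g | ψ g ^ p = -(2 * u) - ψ g₀ ^ p}
  have hsub : {g : V | (u + ψ g ^ p) ^ 2 = w} ⊆ T₁ ∪ T₂ := by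
    intro g hg
    simp only [Set.mem_ofPred_eq] at hg h₀
    rcases sq_eq_sq_iff_eq_or_eq_neg.1 (hg.trans h₀.symm) with h | h
    · left; exact frob _ _ (add_left_cancel h)
    · right
      change ψ g ^ p = _
      linear_combination h
  have h1 := card_fiber_mul_le ψ ι hι T₁ (fun g hg g' hg' => hg.trans hg'.symm)
  have h2 := card_fiber_mul_le ψ ι hι T₂ (fun g hg g' hg' => frob _ _ (hg.trans hg'.symm))
  have h3 : Nat.card {g : V | (u + ψ g ^ p) ^ 2 = w} ≤ Nat.card T₁ + Nat.card T₂ :=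
    (Nat.card_mono (Set.toFinite _) hsub).trans (by
      simpa only [Nat.card_coe_set_eq] using Set.ncard_union_le T₁ T₂)
  calc _ ≤ (Nat.card T₁ + Nat.card T₂) * Nat.card U := Nat.mul_le_mul_right _ h3
    _ ≤ 2 * Nat.card V := by rw [add_mul]; omega

end Counting

section Frobenius

variable {K : Type*} [Field K] [Algebra F K]

variable (F K) in
/-- The `n`-th power of the `#F`-Frobenius endomorphism of `K`. -/
def frobPow (n : ℕ) : K →ₐ[F] K := FiniteField.frobeniusAlgHom F K ^ n

theorem frobPow_apply (n : ℕ) (a : K) : frobPow F K n a = a ^ Fintype.card F ^ n := by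
  rw [frobPow, AlgHom.coe_pow, FiniteField.coe_frobeniusAlgHom, pow_iterate]

variable (F K) in
/-- The subfield of `K` fixed by the `n`-th power of the `#F`-Frobenius. -/
def fixedSubfield (n : ℕ) : Subfield K := (frobPow F K n : K →+* K).eqLocusField (RingHom.id K)

theorem mem_fixedSubfield {n : ℕ} {a : K} :
    a ∈ fixedSubfield F K n ↔ a ^ Fintype.card F ^ n = a := by
  rw [← frobPow_apply]; rfl

theorem card_fixedSubfield [IsAlgClosed K] {n : ℕ} (hn : n ≠ 0) :
    Nat.card (fixedSubfield F K n) = Fintype.card F ^ n := by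
  classical
  obtain ⟨p, _, m, hp, hcard⟩ := FiniteField.card' F
  have : CharP K p := charP_of_injective_algebraMap' F p
  have hq : 1 < Fintype.card F := Fintype.one_lt_card
  set f : Polynomial K := Polynomial.X ^ Fintype.card F ^ n - Polynomial.X
  have hf : f ≠ 0 := FiniteField.X_pow_card_pow_sub_X_ne_zero K hn hq
  have hsep : f.Separable := by
    apply galois_poly_separable p
    rw [hcard]
    exact dvd_pow (dvd_pow_self p m.ne_zero) hn
  have h1 : Nat.card (f.rootSet K) = Fintype.card F ^ n := by
    rw [Nat.card_eq_fintype_card, Polynomial.card_rootSet_eq_natDegree (K := K) hsep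
      (IsAlgClosed.splits _), FiniteField.X_pow_card_pow_sub_X_natDegree_eq K hn hq]
  rw [← h1]
  refine Nat.card_congr (Equiv.subtypeEquivRight fun a => ?_)
  rw [mem_fixedSubfield, Polynomial.mem_rootSet]
  simp [hf, f, sub_eq_zero]

theorem pow_card_pow_natDegree_minpoly {a : K} (hint : IsIntegral F a) :
    a ^ Fintype.card F ^ (minpoly F a).natDegree = a := by
  let L := IntermediateField.adjoin F {a}
  have : FiniteDimensional F L := IntermediateField.adjoin.finiteDimensional hint
  have : Finite L := Module.finite_of_finite F
  have := Fintype.ofFinite L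
  rw [← IntermediateField.adjoin.finrank hint]
  have h := FiniteField.pow_card (⟨a, IntermediateField.mem_adjoin_simple_self F a⟩ : L)
  rw [Module.card_eq_pow_finrank (K := F)] at h
  exact congrArg Subtype.val h

theorem exists_pow_card_pow_eq_self [Algebra.IsAlgebraic F K] (a : K) :
    ∃ n, 0 < n ∧ a ^ Fintype.card F ^ n = a :=
  ⟨_, minpoly.natDegree_pos (Algebra.IsIntegral.isIntegral a),
    pow_card_pow_natDegree_minpoly (Algebra.IsIntegral.isIntegral a)⟩

theorem pow_pow_mul_eq_self {M : Type*} [Monoid M] {a : M} {q n : ℕ} (h : a ^ q ^ n = a) (m : ℕ) :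
    a ^ q ^ (n * m) = a := by
  induction m with
  | zero => simp
  | succ m ih => rw [Nat.mul_succ, pow_add, pow_mul, ih, h]

theorem exists_pow_card_pow_eq_self_of_finset [Algebra.IsAlgebraic F K] (s : Finset K) :
    ∃ n, 0 < n ∧ ∀ a ∈ s, a ^ Fintype.card F ^ n = a := by
  classical
  induction s using Finset.induction_on with
  | empty => exact ⟨1, one_pos, by simp⟩
  | insert b s _ ih =>
    obtain ⟨n, hn, h⟩ := ih
    obtain ⟨m, hm, h'⟩ := exists_pow_card_pow_eq_self (F := F) b
    refine ⟨n * m, Nat.mul_pos hn hm, fun a ha => ?_⟩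
    rcases Finset.mem_insert.1 ha with rfl | ha
    · rw [mul_comm]; exact pow_pow_mul_eq_self h' n
    · exact pow_pow_mul_eq_self (h a ha) m

theorem mem_range_algebraMap_of_pow_card_eq_self {a : K} (h : a ^ Fintype.card F = a) :
    ∃ b : F, algebraMap F K b = a := by
  classical
  by_contra! hne
  have hq : 1 < Fintype.card F := Fintype.one_lt_card
  set f : Polynomial K := Polynomial.X ^ Fintype.card F - Polynomial.X with hfdef
  have hf : f ≠ 0 := FiniteField.X_pow_card_sub_X_ne_zero K hq
  have hinj := (algebraMap F K).injective
  set s : Finset K := insert a (Finset.univ.image (algebraMap F K)) with hs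
  have hcard : s.card = Fintype.card F + 1 := by
    rw [hs, Finset.card_insert_of_notMem (by simpa using hne),
      Finset.card_image_of_injective _ hinj,
      Finset.card_univ]
  have hle := Polynomial.card_le_degree_of_subset_roots (p := f) (Z := s) (by
    intro x hx
    rw [Polynomial.mem_roots hf]
    rw [Finset.mem_val, hs, Finset.mem_insert] at hx
    rcases hx with rfl | hx
    · simp [hfdef, h]
    · obtain ⟨b, -, rfl⟩ := Finset.mem_image.1 hx
      simp [hfdef, ← map_pow, FiniteField.pow_card])
  rw [FiniteField.X_pow_card_sub_X_natDegree_eq K hq] at hle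
  omega

/-- There are elements of `F_{q^N}` of trace one. -/
theorem exists_sum_pow_card_pow_eq_one [IsAlgClosed K] {N : ℕ} (hN : 0 < N) :
    ∃ c : K, c ^ Fintype.card F ^ N = c ∧ ∑ i ∈ Finset.range N, c ^ Fintype.card F ^ i = 1 := by
  classical
  have hq : 1 < Fintype.card F := Fintype.one_lt_card
  set tr : K → K := fun c => ∑ i ∈ Finset.range N, c ^ Fintype.card F ^ i with htr
  have hfix : ∀ c, c ^ Fintype.card F ^ N = c → tr c ^ Fintype.card F = tr c := by
    intro c hc
    have h1 : tr c ^ Fintype.card F = ∑ i ∈ Finset.range N, c ^ Fintype.card F ^ (i + 1) := by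
      have h2 := map_sum (frobPow F K 1) (fun i => c ^ Fintype.card F ^ i) (Finset.range N)
      simp only [frobPow_apply, pow_one, ← pow_mul, ← pow_succ] at h2
      exact h2
    rw [h1, htr]
    have h3 := Finset.sum_range_succ' (fun i => c ^ Fintype.card F ^ i) N
    have h4 := Finset.sum_range_succ (fun i => c ^ Fintype.card F ^ i) N
    rw [h3] at h4
    simp only [hc, pow_zero, pow_one] at h4
    exact add_right_cancel h4
  obtain ⟨c, hc, hc0⟩ : ∃ c, c ^ Fintype.card F ^ N = c ∧ tr c ≠ 0 := by
    by_contra! hcon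
    set g : Polynomial K := ∑ i ∈ Finset.range N, Polynomial.X ^ Fintype.card F ^ i with hg
    have hgdeg : g.natDegree ≤ Fintype.card F ^ (N - 1) := by
      refine Polynomial.natDegree_sum_le_of_forall_le _ _ fun i hi => ?_
      rw [Polynomial.natDegree_X_pow]
      exact Nat.pow_le_pow_right hq.le (by have := Finset.mem_range.1 hi; omega)
    have hg0 : g ≠ 0 := by
      intro h
      have h1 : g.coeff 1 = 1 := by
        rw [hg, Polynomial.finsetSum_coeff, Finset.sum_eq_single 0]
        · simp
        · intro b _ hb
          rw [Polynomial.coeff_X_pow, if_neg]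
          exact (Nat.one_lt_pow hb hq).ne
        · intro h0; exact absurd (Finset.mem_range.2 hN) h0
      rw [h] at h1; simp at h1
    have hfin : Finite (fixedSubfield F K N) := Nat.finite_of_card_ne_zero (by
      rw [card_fixedSubfield hN.ne']; positivity)
    have hle := Polynomial.card_le_degree_of_subset_roots (p := g)
      (Z := (Set.toFinite (fixedSubfield F K N : Set K)).toFinset) (by
        intro x hx
        rw [Polynomial.mem_roots hg0]
        have hx' : x ∈ fixedSubfield F K N := by simpa using hx
        have := hcon x (mem_fixedSubfield.1 hx')
        simpa [hg, Polynomial.eval_finsetSum] using this)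
    rw [← Set.ncard_eq_toFinset_card _ (Set.toFinite _), ← Nat.card_coe_set_eq] at hle
    have := card_fixedSubfield (F := F) (K := K) hN.ne'
    have h5 : Fintype.card F ^ (N - 1) < Fintype.card F ^ N :=
      Nat.pow_lt_pow_right hq (by omega)
    have h6 : Nat.card (fixedSubfield F K N) ≤ g.natDegree := hle
    omega
  obtain ⟨b, hb⟩ := mem_range_algebraMap_of_pow_card_eq_self (hfix c hc)
  have hb0 : b ≠ 0 := by rintro rfl; exact hc0 (by rw [← hb, map_zero])
  have hpow : ∀ i, algebraMap F K b⁻¹ ^ Fintype.card F ^ i = algebraMap F K b⁻¹ := fun i => by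
    rw [← map_pow, FiniteField.pow_card_pow]
  refine ⟨algebraMap F K b⁻¹ * c, ?_, ?_⟩
  · rw [mul_pow, hpow, hc]
  · simp only [mul_pow, hpow, ← Finset.mul_sum]
    change algebraMap F K b⁻¹ * tr c = 1
    rw [← hb, ← map_mul, inv_mul_cancel₀ hb0, map_one]

end Frobenius

section Points

variable {K : Type*} [Field K]

open Classical in
/-- The first nonzero coordinate of a point (with value `2` if the first two coordinates vanish). -/
def chart (pt : Fin 3 → K) : Fin 3 := if pt 0 ≠ 0 then 0 else if pt 1 ≠ 0 then 1 else 2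

/-- A coordinate vector is normalized if its first nonzero coordinate is `1`. -/
def IsNormalized (pt : Fin 3 → K) : Prop := pt (chart pt) = 1

theorem isNormalized_iff (pt : Fin 3 → K) : IsNormalized pt ↔
    pt 0 = 1 ∨ (pt 0 = 0 ∧ pt 1 = 1) ∨ (pt 0 = 0 ∧ pt 1 = 0 ∧ pt 2 = 1) := by
  unfold IsNormalized chart
  by_cases h0 : pt 0 = 0 <;> by_cases h1 : pt 1 = 0 <;> simp [h0, h1]

theorem exists_smul_isNormalized {pt : Fin 3 → K} (h : pt ≠ 0) :
    ∃ c : K, c ≠ 0 ∧ IsNormalized (c • pt) := by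
  simp only [isNormalized_iff, Pi.smul_apply, smul_eq_mul]
  by_cases h0 : pt 0 = 0
  · by_cases h1 : pt 1 = 0
    · by_cases h2 : pt 2 = 0
      · exact absurd (_root_.funext fun i => by fin_cases i <;> simp [h0, h1, h2]) h
      · exact ⟨(pt 2)⁻¹, inv_ne_zero h2, by simp [h0, h1, h2]⟩
    · exact ⟨(pt 1)⁻¹, inv_ne_zero h1, by simp [h0, h1]⟩
  · exact ⟨(pt 0)⁻¹, inv_ne_zero h0, by simp [h0]⟩

theorem IsNormalized.exists_minor_ne_zero {P R : Fin 3 → K} (hP : IsNormalized P)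
    (hR : IsNormalized R) (h : R ≠ P) : ∃ a b, R a * P b - R b * P a ≠ 0 := by
  by_contra! hcon
  refine h (_root_.funext fun i => ?_)
  have h01 := hcon 0 1
  have h02 := hcon 0 2
  have h12 := hcon 1 2
  rw [isNormalized_iff] at hP hR
  rcases hP with hP | ⟨hP, hP'⟩ | ⟨hP, hP', hP''⟩ <;>
  rcases hR with hR | ⟨hR, hR'⟩ | ⟨hR, hR', hR''⟩ <;>
  simp_all [sub_eq_zero] <;> fin_cases i <;> simp_all

variable [Algebra F K]

variable (F) in
/-- The coordinatewise `#F`-Frobenius. -/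
def ptFrob (pt : Fin 3 → K) : Fin 3 → K := fun i => pt i ^ Fintype.card F

omit [Field F] [Algebra F K] in
theorem ptFrob_iterate (n : ℕ) (pt : Fin 3 → K) :
    (ptFrob F)^[n] pt = fun i => pt i ^ Fintype.card F ^ n := by
  induction n with
  | zero => simp
  | succ n ih => rw [Function.iterate_succ_apply', ih]; funext i; simp [ptFrob, ← pow_mul, pow_succ]

omit [Algebra F K] in
theorem chart_ptFrob_iterate (n : ℕ) (pt : Fin 3 → K) :
    chart ((ptFrob F)^[n] pt) = chart pt := by
  have h : ∀ a : K, a ^ Fintype.card F ^ n = 0 ↔ a = 0 := fun a =>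
    pow_eq_zero_iff (pow_ne_zero n Fintype.card_ne_zero)
  rw [ptFrob_iterate]
  unfold chart
  congr 1
  · rw [ne_eq, h]
  · congr 1
    rw [ne_eq, h]

omit [Algebra F K] in
theorem IsNormalized.ptFrob_iterate {pt : Fin 3 → K} (h : IsNormalized pt) (n : ℕ) :
    IsNormalized ((ptFrob F)^[n] pt) := by
  unfold IsNormalized at *
  rw [chart_ptFrob_iterate, _root_.ptFrob_iterate]
  simp [h]

variable (F) in
/-- The degree over `F` of a point. -/
def ptDegree (pt : Fin 3 → K) : ℕ := Function.minimalPeriod (ptFrob F) pt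

theorem exists_iterate_ptFrob_eq_self [Algebra.IsAlgebraic F K] (s : Finset (Fin 3 → K)) :
    ∃ n, 0 < n ∧ ∀ pt ∈ s, (ptFrob F)^[n] pt = pt := by
  classical
  obtain ⟨n, hn, h⟩ := exists_pow_card_pow_eq_self_of_finset (F := F)
    (s.biUnion fun pt => Finset.univ.image pt)
  refine ⟨n, hn, fun pt hpt => ?_⟩
  rw [ptFrob_iterate]
  funext i
  exact h _ (Finset.mem_biUnion.2 ⟨pt, hpt, Finset.mem_image_of_mem _ (Finset.mem_univ i)⟩)

theorem ptDegree_pos [Algebra.IsAlgebraic F K] (pt : Fin 3 → K) : 0 < ptDegree F pt := by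
  obtain ⟨n, hn, h⟩ := exists_iterate_ptFrob_eq_self (F := F) {pt}
  exact Function.IsPeriodicPt.minimalPeriod_pos hn (h pt (Finset.mem_singleton_self _))

omit [Field F] [Algebra F K] in
theorem iterate_ptDegree (pt : Fin 3 → K) : (ptFrob F)^[ptDegree F pt] pt = pt :=
  Function.isPeriodicPt_minimalPeriod (ptFrob F) pt

variable (F K) in
/-- The normalized points with coordinates fixed by the `n`-th power of Frobenius. -/
def rationalPoints (n : ℕ) : Set (Fin 3 → K) := {pt | IsNormalized pt ∧ (ptFrob F)^[n] pt = pt}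

theorem card_rationalPoints [IsAlgClosed K] {n : ℕ} (hn : n ≠ 0) :
    Nat.card (rationalPoints F K n) =
      Fintype.card F ^ (2 * n) + Fintype.card F ^ n + 1 := by
  set κ := fixedSubfield F K n
  have hκ : Nat.card κ = Fintype.card F ^ n := card_fixedSubfield hn
  have : Finite κ := Nat.finite_of_card_ne_zero (by rw [hκ]; positivity)
  have hc : Fintype.card F ≠ 0 := Fintype.card_ne_zero
  have hmem : ∀ pt : Fin 3 → K, pt ∈ rationalPoints F K n ↔ IsNormalized pt ∧ ∀ i, pt i ∈ κ := by
    intro pt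
    simp [rationalPoints, ptFrob_iterate, κ, mem_fixedSubfield, funext_iff]
  let f : (κ × κ) ⊕ (κ ⊕ Unit) → rationalPoints F K n :=
    Sum.elim (fun ab => ⟨![1, ab.1, ab.2], by
      rw [hmem, isNormalized_iff]; simp [Fin.forall_fin_succ, one_mem]⟩)
      (Sum.elim (fun a => ⟨![0, 1, a], by
        rw [hmem, isNormalized_iff]; simp [Fin.forall_fin_succ, one_mem, zero_mem]⟩)
      (fun _ => ⟨![0, 0, 1], by
        rw [hmem, isNormalized_iff]; simp [Fin.forall_fin_succ, one_mem, zero_mem]⟩))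
  have hf : Function.Bijective f := by
    constructor
    · rintro (⟨a, b⟩ | a | a) (⟨a', b'⟩ | a' | a') h
      all_goals
        have h0 := congrFun (congrArg Subtype.val h) 0
        have h1 := congrFun (congrArg Subtype.val h) 1
        have h2 := congrFun (congrArg Subtype.val h) 2
        simp [f] at h0 h1 h2
      · rw [h1, h2]
      · rw [h2]
      · rfl
    · rintro ⟨pt, hpt⟩
      obtain ⟨h1, h2⟩ := (hmem pt).1 hpt
      rw [isNormalized_iff] at h1
      rcases h1 with h | ⟨h, h'⟩ | ⟨h, h', h''⟩
      · refine ⟨Sum.inl (⟨pt 1, h2 1⟩, ⟨pt 2, h2 2⟩), Subtype.ext (_root_.funext fun i => ?_)⟩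
        fin_cases i <;> simp [f, h]
      · refine ⟨Sum.inr (Sum.inl ⟨pt 2, h2 2⟩), Subtype.ext (_root_.funext fun i => ?_)⟩
        fin_cases i <;> simp [f, h, h']
      · refine ⟨Sum.inr (Sum.inr ()), Subtype.ext (_root_.funext fun i => ?_)⟩
        fin_cases i <;> simp [f, h, h', h'']
  rw [← Nat.card_congr (Equiv.ofBijective f hf), Nat.card_sum, Nat.card_sum, Nat.card_prod, hκ]
  simp
  ring

theorem finite_rationalPoints [IsAlgClosed K] {n : ℕ} (hn : n ≠ 0) :
    (rationalPoints F K n).Finite :=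
  Nat.finite_of_card_ne_zero (by rw [card_rationalPoints hn]; positivity)

variable (F K) in
/-- The normalized points of degree exactly `n`. -/
def pointsOfDegree (n : ℕ) : Set (Fin 3 → K) := {pt | IsNormalized pt ∧ ptDegree F pt = n}

omit [Field F] [Algebra F K] in
theorem pointsOfDegree_subset (n : ℕ) : pointsOfDegree F K n ⊆ rationalPoints F K n := by
  rintro pt ⟨h, rfl⟩
  exact ⟨h, iterate_ptDegree pt⟩

theorem finite_pointsOfDegree [IsAlgClosed K] [Algebra.IsAlgebraic F K] (n : ℕ) :
    (pointsOfDegree F K n).Finite := by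
  rcases eq_or_ne n 0 with rfl | hn
  · convert Set.finite_empty
    ext pt
    simp [pointsOfDegree, (ptDegree_pos pt).ne']
  · exact (finite_rationalPoints hn).subset (pointsOfDegree_subset n)

theorem card_pointsOfDegree_le [IsAlgClosed K] {n : ℕ} (hn : n ≠ 0) :
    (pointsOfDegree F K n).ncard ≤ 3 * Fintype.card F ^ (2 * n) := by
  have hq : 1 ≤ Fintype.card F := Fintype.card_pos
  refine (Set.ncard_le_ncard (pointsOfDegree_subset n) (finite_rationalPoints hn)).trans ?_
  rw [← Nat.card_coe_set_eq, card_rationalPoints hn]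
  have h1 : Fintype.card F ^ n ≤ Fintype.card F ^ (2 * n) := Nat.pow_le_pow_right hq (by omega)
  have h2 : 1 ≤ Fintype.card F ^ (2 * n) := Nat.one_le_pow _ _ hq
  omega

theorem sum_card_pointsOfDegree [IsAlgClosed K] [Algebra.IsAlgebraic F K] {n : ℕ} (hn : n ≠ 0) :
    ∑ e ∈ n.divisors, (pointsOfDegree F K e).ncard =
      Fintype.card F ^ (2 * n) + Fintype.card F ^ n + 1 := by
  classical
  rw [← card_rationalPoints (K := K) hn, Nat.card_coe_set_eq,
    Set.ncard_eq_toFinset_card _ (finite_rationalPoints hn),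
    Finset.card_eq_sum_card_fiberwise (f := ptDegree F) (t := n.divisors)]
  · refine Finset.sum_congr rfl fun e he => ?_
    rw [Set.ncard_eq_toFinset_card _ (finite_pointsOfDegree e)]
    congr 1
    ext pt
    simp only [Set.Finite.mem_toFinset, Finset.mem_filter, pointsOfDegree, rationalPoints,
      Set.mem_ofPred_eq]
    constructor
    · rintro ⟨h, rfl⟩
      exact ⟨⟨h, Function.isPeriodicPt_iff_minimalPeriod_dvd.2 (Nat.dvd_of_mem_divisors he)⟩, rfl⟩
    · rintro ⟨⟨h, -⟩, h'⟩
      exact ⟨h, h'⟩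
  · intro pt hpt
    rw [Set.Finite.coe_toFinset] at hpt
    exact Nat.mem_divisors.2 ⟨Function.isPeriodicPt_iff_minimalPeriod_dvd.1 hpt.2, hn⟩

end Points

section Jets

variable {K : Type*} [Field K]

/-- The first-order jet of a form at a normalized point: its value, and its partial derivatives
in the affine coordinates of the chart of the point. -/
def jet {R : Type*} [CommRing R] [Algebra R K] (pt : Fin 3 → K) (G : MvPolynomial (Fin 3) R) :
    Fin 3 → K :=
  fun j => if j = chart pt then aeval pt G else aeval pt (pderiv j G)

theorem jet_add {R : Type*} [CommRing R] [Algebra R K] (pt : Fin 3 → K)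
    (G H : MvPolynomial (Fin 3) R) : jet pt (G + H) = jet pt G + jet pt H := by
  funext j
  by_cases h : j = chart pt <;> simp [jet, h]

theorem jet_smul {R : Type*} [CommRing R] [Algebra R K] (pt : Fin 3 → K) (c : R)
    (G : MvPolynomial (Fin 3) R) : jet pt (c • G) = c • jet pt G := by
  funext j
  by_cases h : j = chart pt <;> simp [jet, h]

/-- The jet map at a point, as a linear map. -/
def jetHom (R : Type*) [CommRing R] [Algebra R K] (pt : Fin 3 → K) :
    MvPolynomial (Fin 3) R →ₗ[R] (Fin 3 → K) where
  toFun := jet pt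
  map_add' := jet_add pt
  map_smul' := jet_smul pt

theorem jet_sum {R ι : Type*} [CommRing R] [Algebra R K] (pt : Fin 3 → K) (s : Finset ι)
    (G : ι → MvPolynomial (Fin 3) R) : jet pt (∑ i ∈ s, G i) = ∑ i ∈ s, jet pt (G i) :=
  map_sum (jetHom R pt) G s

theorem jet_sq_mul {pt : Fin 3 → K} {l : MvPolynomial (Fin 3) K} (hl : aeval pt l = 0)
    (N : MvPolynomial (Fin 3) K) : jet pt (l ^ 2 * N) = 0 := by
  funext j
  have hl' : eval pt l = 0 := by rw [← coe_aeval_eq_eval]; exact hl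
  by_cases h : j = chart pt
  · simp [jet, h, hl']
  · simp [jet, h, hl']

theorem exists_jet_eq_of_ne {Z : Finset (Fin 3 → K)} (hZ : ∀ R ∈ Z, IsNormalized R)
    {P : Fin 3 → K} (hP : P ∈ Z) {d : ℕ} (hd : 2 * Z.card ≤ d + 1) (t : Fin 3 → K) :
    ∃ G : MvPolynomial (Fin 3) K, G.IsHomogeneous d ∧ jet P G = t ∧
      ∀ R ∈ Z, R ≠ P → jet R G = 0 := by
  classical
  have hab : ∀ R : Fin 3 → K, ∃ a b : Fin 3, R ∈ Z.erase P → R a * P b - R b * P a ≠ 0 := by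
    intro R
    by_cases h : R ∈ Z.erase P
    · obtain ⟨a, b, h'⟩ := (hZ P hP).exists_minor_ne_zero (hZ R (Finset.mem_of_mem_erase h))
        (Finset.ne_of_mem_erase h)
      exact ⟨a, b, fun _ => h'⟩
    · exact ⟨0, 0, fun h' => absurd h' h⟩
  choose a b hab using hab
  set l : (Fin 3 → K) → MvPolynomial (Fin 3) K := fun R =>
    C (R (a R)) * X (b R) - C (R (b R)) * X (a R)
    with hl
  have hlhom : ∀ R, (l R).IsHomogeneous 1 := fun R => by
    refine IsHomogeneous.sub ?_ ?_
    · simpa using (isHomogeneous_C (Fin 3) (R (a R))).mul (isHomogeneous_X K (b R))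
    · simpa using (isHomogeneous_C (Fin 3) (R (b R))).mul (isHomogeneous_X K (a R))
  have hcard : 0 < Z.card := Finset.card_pos.2 ⟨P, hP⟩
  set i := chart P
  have hPi : P i = 1 := hZ P hP
  set M : MvPolynomial (Fin 3) K :=
    (∏ R ∈ Z.erase P, l R ^ 2) * X i ^ (d - 1 - 2 * (Z.card - 1)) with hM
  have hMhom : M.IsHomogeneous (d - 1) := by
    have h1 : (∏ R ∈ Z.erase P, l R ^ 2).IsHomogeneous (∑ R ∈ Z.erase P, 1 * 2) :=
      IsHomogeneous.prod _ _ _ fun R _ => (hlhom R).pow 2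
    have h2 := h1.mul (isHomogeneous_X_pow (R := K) i (d - 1 - 2 * (Z.card - 1)))
    convert h2 using 1
    rw [Finset.sum_const, Finset.card_erase_of_mem hP, smul_eq_mul]
    omega
  set m : K := aeval P M with hm
  have hm0 : m ≠ 0 := by
    rw [hm, hM, map_mul, map_prod, map_pow, aeval_X, hPi, one_pow, mul_one]
    refine Finset.prod_ne_zero_iff.2 fun R hR => ?_
    rw [map_pow]
    refine pow_ne_zero _ ?_
    have := hab R hR
    simpa [hl] using this
  set lam : K := t i / m with hlam
  set c : Fin 3 → K := fun j => (t j - aeval P (pderiv j M) * lam) / m with hc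
  set L : MvPolynomial (Fin 3) K :=
    C lam * X i + ∑ j ∈ Finset.univ.erase i, C (c j) * (X j - C (P j) * X i) with hL
  have hLhom : L.IsHomogeneous 1 := by
    refine IsHomogeneous.add ?_ (IsHomogeneous.sum _ _ _ fun j _ => ?_)
    · simpa using (isHomogeneous_C (Fin 3) lam).mul (isHomogeneous_X K i)
    · have h1 : (X j - C (P j) * X i : MvPolynomial (Fin 3) K).IsHomogeneous 1 := by
        refine (isHomogeneous_X K j).sub ?_
        simpa using (isHomogeneous_C (Fin 3) (P j)).mul (isHomogeneous_X K i)
      simpa using (isHomogeneous_C (Fin 3) (c j)).mul h1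
  have hLP : aeval P L = lam := by
    simp [hL, hPi]
  have hLd : ∀ j, j ≠ i → aeval P (pderiv j L) = c j := by
    intro j hj
    rw [hL, map_add, map_sum, Finset.sum_eq_single j]
    · simp [pderiv_X_of_ne hj.symm]
    · intro b _ hb
      simp [pderiv_X_of_ne hj.symm, pderiv_X_of_ne hb]
    · intro h; exact absurd (Finset.mem_erase.2 ⟨hj, Finset.mem_univ j⟩) h
  refine ⟨M * L, ?_, ?_, ?_⟩
  · have := hMhom.mul hLhom
    rwa [Nat.sub_add_cancel (by omega)] at this
  · funext j
    by_cases hj : j = i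
    · subst hj
      simp only [jet, i, if_true]
      rw [map_mul, hLP, ← hm, hlam, mul_div_cancel₀ _ hm0]
    · simp only [jet]
      rw [if_neg hj, pderiv_mul (f := M) (g := L), map_add, map_mul (aeval P), map_mul (aeval P),
        hLP,
        hLd j hj, ← hm]
      simp only [hc]
      field_simp
      ring
  · intro R hR hne
    have hR' := Finset.mem_erase.2 ⟨hne, hR⟩
    rw [hM, ← Finset.mul_prod_erase _ _ hR', mul_assoc, mul_assoc]
    refine jet_sq_mul ?_ _
    simp only [hl, map_sub, map_mul, aeval_X, aeval_C, Algebra.algebraMap_self, RingHom.id_apply]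
    ring

theorem exists_jet_eq {Z : Finset (Fin 3 → K)} (hZ : ∀ R ∈ Z, IsNormalized R)
    {d : ℕ} (hd : 2 * Z.card ≤ d + 1) (t : (Fin 3 → K) → Fin 3 → K) :
    ∃ G : MvPolynomial (Fin 3) K, G.IsHomogeneous d ∧ ∀ R ∈ Z, jet R G = t R := by
  classical
  have h : ∀ P, ∃ G : MvPolynomial (Fin 3) K, P ∈ Z → (G.IsHomogeneous d ∧ jet P G = t P ∧
      ∀ R ∈ Z, R ≠ P → jet R G = 0) := by
    intro P
    by_cases hP : P ∈ Z
    · obtain ⟨G, hG⟩ := exists_jet_eq_of_ne hZ hP hd (t P)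
      exact ⟨G, fun _ => hG⟩
    · exact ⟨0, fun h => absurd h hP⟩
  choose G hG using h
  refine ⟨∑ P ∈ Z, G P, IsHomogeneous.sum _ _ _ fun P hP => (hG P hP).1, fun R hR => ?_⟩
  rw [jet_sum, Finset.sum_eq_single R]
  · exact (hG R hR).2.1
  · intro P hP hne
    exact (hG P hP).2.2 R hR hne.symm
  · intro h; exact absurd hR h

variable [Algebra F K]

theorem jet_map_frobPow (n : ℕ) (pt : Fin 3 → K) (G : MvPolynomial (Fin 3) K) :
    jet ((ptFrob F)^[n] pt) (map (frobPow F K n : K →+* K) G) =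
      fun j => frobPow F K n (jet pt G j) := by
  have key : ∀ H : MvPolynomial (Fin 3) K,
      aeval ((ptFrob F)^[n] pt) (map (frobPow F K n : K →+* K) H) = frobPow F K n (aeval pt H) := by
    intro H
    have h1 : (ptFrob F)^[n] pt = fun i => frobPow F K n (pt i) := by
      rw [ptFrob_iterate]; funext i; rw [frobPow_apply]
    rw [h1, aeval_def, eval₂_map, aeval_def]
    have := eval₂_comp_left (frobPow F K n : K →+* K) (algebraMap K K) pt H
    simpa [Function.comp_def] using this.symm
  funext j
  simp only [jet, chart_ptFrob_iterate]
  split_ifs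
  · exact key G
  · rw [pderiv_map, key]

omit [Fintype F] in
theorem jet_map_algebraMap (pt : Fin 3 → K) (G : MvPolynomial (Fin 3) F) :
    jet pt (map (algebraMap F K) G) = jet pt G := by
  funext j
  simp only [jet, pderiv_map, aeval_map_algebraMap]

theorem map_frobPow_map_algebraMap (n : ℕ) (G : MvPolynomial (Fin 3) F) :
    map (frobPow F K n : K →+* K) (map (algebraMap F K) G) = map (algebraMap F K) G := by
  have h : (frobPow F K n : K →+* K).comp (algebraMap F K) = algebraMap F K :=
    RingHom.ext fun a => by simp
  rw [MvPolynomial.map_map, h]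

theorem jet_ptFrob_iterate (n : ℕ) (pt : Fin 3 → K) (G : MvPolynomial (Fin 3) F) :
    jet ((ptFrob F)^[n] pt) G = fun j => frobPow F K n (jet pt G j) := by
  rw [← jet_map_algebraMap, ← map_frobPow_map_algebraMap n, jet_map_frobPow, jet_map_algebraMap]

theorem jet_mem_fixedSubfield (pt : Fin 3 → K) (G : MvPolynomial (Fin 3) F) (j : Fin 3) :
    jet pt G j ∈ fixedSubfield F K (ptDegree F pt) := by
  have h := congrFun (jet_ptFrob_iterate (ptDegree F pt) pt G) j
  rw [iterate_ptDegree] at h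
  exact h.symm

end Jets

section Descent

variable {K : Type*} [Field K] [Algebra F K]

variable (F) in
/-- Distinct elements of the set lie in distinct Frobenius orbits. -/
def OrbitIndependent (O : Finset (Fin 3 → K)) : Prop :=
  ∀ P ∈ O, ∀ Q ∈ O, ∀ i j : ℕ, (ptFrob F)^[i] P = (ptFrob F)^[j] Q → P = Q

theorem exists_map_algebraMap_eq_sum_frobPow {N : ℕ} {G : MvPolynomial (Fin 3) K}
    (hG : ∀ m, coeff m G ^ Fintype.card F ^ N = coeff m G) :
    ∃ H : MvPolynomial (Fin 3) F, map (algebraMap F K) H =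
      ∑ i ∈ Finset.range N, map (frobPow F K i : K →+* K) G := by
  rw [← Set.mem_range, mem_range_map_iff_coeffs_subset]
  intro a ha
  obtain ⟨m, -, rfl⟩ := mem_coeffs_iff.1 ha
  obtain ⟨b, hb⟩ := mem_range_algebraMap_of_pow_card_eq_self (F := F) (K := K)
    (a := coeff m (∑ i ∈ Finset.range N, map (frobPow F K i : K →+* K) G)) (by
      rw [coeff_sum]
      simp only [coeff_map, RingHom.coe_coe]
      have h1 : ∀ b : K, b ^ Fintype.card F = frobPow F K 1 b := fun b => by simp [frobPow_apply]
      rw [h1, map_sum]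
      simp only [frobPow_apply, pow_one, ← pow_mul, ← pow_succ]
      have h2 := Finset.sum_range_succ (fun i => coeff m G ^ Fintype.card F ^ i) N
      rw [Finset.sum_range_succ', hG m, pow_zero, pow_one] at h2
      exact add_right_cancel h2)
  exact ⟨b, hb⟩

omit [Field F] [Algebra F K] in
theorem pow_card_pow_mod {a : K} {e : ℕ} (h : a ^ Fintype.card F ^ e = a) (i : ℕ) :
    a ^ Fintype.card F ^ (i % e) = a ^ Fintype.card F ^ i := by
  conv_rhs => rw [← Nat.div_add_mod i e, pow_add, pow_mul, pow_pow_mul_eq_self h]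

theorem exists_jet_eq_over_base [IsAlgClosed K] [Algebra.IsAlgebraic F K]
    {O : Finset (Fin 3 → K)} (hO : ∀ P ∈ O, IsNormalized P) (hind : OrbitIndependent F O) {d : ℕ}
    (hd : 2 * ∑ P ∈ O, ptDegree F P ≤ d + 1) (t : (Fin 3 → K) → Fin 3 → K)
    (ht : ∀ P ∈ O, ∀ j, t P j ∈ fixedSubfield F K (ptDegree F P)) :
    ∃ G : MvPolynomial (Fin 3) F, G.IsHomogeneous d ∧ ∀ P ∈ O, jet P G = t P := by
  classical
  set Z : Finset (Fin 3 → K) :=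
    O.biUnion fun P => (Finset.range (ptDegree F P)).image fun i => (ptFrob F)^[i] P with hZ
  have hZcard : 2 * Z.card ≤ d + 1 := by
    refine le_trans (Nat.mul_le_mul_left 2 (Finset.card_biUnion_le.trans ?_)) hd
    exact Finset.sum_le_sum fun P _ => Finset.card_image_le.trans (by simp)
  have hZn : ∀ R ∈ Z, IsNormalized R := by
    intro R hR
    simp only [hZ, Finset.mem_biUnion, Finset.mem_image] at hR
    obtain ⟨P, hP, i, -, rfl⟩ := hR
    exact (hO P hP).ptFrob_iterate i
  have hmem : ∀ P ∈ O, ∀ i, (ptFrob F)^[i] P ∈ Z := by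
    intro P hP i
    simp only [hZ, Finset.mem_biUnion, Finset.mem_image, Finset.mem_range]
    exact ⟨P, hP, i % ptDegree F P, Nat.mod_lt _ (ptDegree_pos P),
      Function.iterate_mod_minimalPeriod_eq⟩
  have hex : ∃ tt : (Fin 3 → K) → Fin 3 → K, ∀ P ∈ O, ∀ i,
      tt ((ptFrob F)^[i] P) = fun j => t P j ^ Fintype.card F ^ i := by
    have h : ∀ R : Fin 3 → K, ∃ s : Fin 3 → K, ∀ P ∈ O, ∀ i, (ptFrob F)^[i] P = R →
        s = fun j => t P j ^ Fintype.card F ^ i := by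
      intro R
      by_cases hR : ∃ P ∈ O, ∃ i, (ptFrob F)^[i] P = R
      · obtain ⟨P, hP, i, hPR⟩ := hR
        refine ⟨fun j => t P j ^ Fintype.card F ^ i, fun Q hQ i' hQR => ?_⟩
        obtain rfl := hind P hP Q hQ i i' (hPR.trans hQR.symm)
        have hmod : i % ptDegree F P = i' % ptDegree F P := by
          have h1 := hPR.trans hQR.symm
          rw [← Function.iterate_mod_minimalPeriod_eq (f := ptFrob F) (n := i),
            ← Function.iterate_mod_minimalPeriod_eq (f := ptFrob F) (n := i')] at h1
          exact (Function.iterate_eq_iterate_iff_of_lt_minimalPeriod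
            (Nat.mod_lt _ (ptDegree_pos P)) (Nat.mod_lt _ (ptDegree_pos P))).1 h1
        funext j
        have hj := mem_fixedSubfield.1 (ht P hP j)
        rw [← pow_card_pow_mod hj i, ← pow_card_pow_mod hj i', hmod]
      · exact ⟨0, fun P hP i h => absurd ⟨P, hP, i, h⟩ hR⟩
    choose tt htt using h
    exact ⟨tt, fun P hP i => htt _ P hP i rfl⟩
  obtain ⟨tt, htt⟩ := hex
  obtain ⟨G, hGhom, hG⟩ := exists_jet_eq hZn hZcard tt
  obtain ⟨N₁, hN₁, h₁⟩ := exists_iterate_ptFrob_eq_self (F := F) O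
  obtain ⟨N₂, hN₂, h₂⟩ := exists_pow_card_pow_eq_self_of_finset (F := F) (G.support.image G.coeff)
  set N := N₁ * N₂ with hN
  have hN0 : 0 < N := Nat.mul_pos hN₁ hN₂
  have hNO : ∀ P ∈ O, (ptFrob F)^[N] P = P := fun P hP => by
    rw [hN, Function.iterate_mul]
    exact Function.iterate_fixed (h₁ P hP) N₂
  obtain ⟨c, hc, hc1⟩ := exists_sum_pow_card_pow_eq_one (F := F) (K := K) hN0
  obtain ⟨H, hH⟩ := exists_map_algebraMap_eq_sum_frobPow (F := F) (N := N) (G := c • G) (by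
    intro m
    rw [coeff_smul, smul_eq_mul, mul_pow, hc]
    congr 1
    by_cases hm : coeff m G = 0
    · rw [hm, zero_pow (pow_ne_zero _ Fintype.card_ne_zero)]
    · rw [hN, mul_comm]
      exact pow_pow_mul_eq_self (h₂ _ (Finset.mem_image_of_mem _ (mem_support_iff.2 hm))) _)
  refine ⟨H, ?_, fun P hP => ?_⟩
  · refine IsHomogeneous.of_map (f := algebraMap F K) (algebraMap F K).injective ?_
    rw [hH]
    refine IsHomogeneous.sum _ _ _ fun i _ => IsHomogeneous.map ?_ _
    rw [smul_eq_C_mul]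
    simpa using (isHomogeneous_C (Fin 3) c).mul hGhom
  · rw [← jet_map_algebraMap, hH, jet_sum]
    have hterm : ∀ i ∈ Finset.range N, jet P (map (frobPow F K i : K →+* K) (c • G)) =
        fun j => c ^ Fintype.card F ^ i * t P j := by
      intro i hi
      have hiN := (Finset.mem_range.1 hi).le
      have hPi : (ptFrob F)^[i] ((ptFrob F)^[N - i] P) = P := by
        rw [← Function.iterate_add_apply, Nat.add_sub_cancel' hiN, hNO P hP]
      conv_lhs => rw [← hPi]
      rw [jet_map_frobPow, jet_smul, hG _ (hmem P hP _), htt P hP]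
      funext j
      rw [frobPow_apply, Pi.smul_apply, smul_eq_mul, mul_pow, ← pow_mul, ← pow_add,
        Nat.sub_add_cancel hiN]
      congr 1
      obtain ⟨m, hm⟩ : ptDegree F P ∣ N := Function.IsPeriodicPt.minimalPeriod_dvd (hNO P hP)
      rw [hm]
      exact pow_pow_mul_eq_self (mem_fixedSubfield.1 (ht P hP j)) m
    rw [Finset.sum_congr rfl hterm]
    funext j
    rw [Finset.sum_apply, ← Finset.sum_mul, hc1, one_mul]

end Descent

section SingularJets

/-- The condition on the first-order jets of `A` and `B` at a point, in the chart `i`, for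
`W_{A,B}` to be singular over this point. -/
def SingJet {κ : Type*} [Field κ] (i : Fin 3) (a b : Fin 3 → κ) : Prop :=
  ∃ x : κ, 3 * x ^ 2 + a i = 0 ∧ x ^ 3 + a i * x + b i = 0 ∧ ∀ j, j ≠ i → a j * x + b j = 0

theorem singJet_coe_iff {K : Type*} [Field K] {κ : Subfield K} (h2 : (2 : K) ≠ 0)
    (h3 : (3 : K) ≠ 0) (i : Fin 3) (a b : Fin 3 → κ) :
    SingJet i (fun j => (a j : K)) (fun j => (b j : K)) ↔ SingJet i a b := by
  constructor
  · rintro ⟨x, hx1, hx2, hx3⟩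
    simp only at hx1 hx2 hx3
    have hx : x ∈ κ := by
      by_cases ha : (a i : K) = 0
      · rw [ha, add_zero, mul_eq_zero, or_iff_right h3, sq_eq_zero_iff] at hx1
        rw [hx1]
        exact κ.zero_mem
      · have : x = -(3 * b i) / (2 * a i) := by
          rw [eq_div_iff (mul_ne_zero h2 ha)]
          linear_combination 3 * hx2 - x * hx1
        rw [this]
        exact κ.div_mem (κ.neg_mem (κ.mul_mem (ofNat_mem κ 3) (b i).2))
          (κ.mul_mem (ofNat_mem κ 2) (a i).2)
    exact ⟨⟨x, hx⟩, Subtype.ext hx1, Subtype.ext hx2, fun j hj => Subtype.ext (hx3 j hj)⟩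
  · rintro ⟨x, hx1, hx2, hx3⟩
    exact ⟨x, congrArg Subtype.val hx1, congrArg Subtype.val hx2,
      fun j hj => congrArg Subtype.val (hx3 j hj)⟩

theorem card_singJet {κ : Type*} [Field κ] (h2 : (2 : κ) ≠ 0)
    (h3 : (3 : κ) ≠ 0) (i : Fin 3) :
    Nat.card {ab : (Fin 3 → κ) × (Fin 3 → κ) | SingJet i ab.1 ab.2} = Nat.card κ ^ 3 := by
  let f : (Fin 3 → κ) → {ab : (Fin 3 → κ) × (Fin 3 → κ) | SingJet i ab.1 ab.2} := fun v =>
    ⟨(fun j => if j = i then -3 * v i ^ 2 else v j,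
        fun j => if j = i then 2 * v i ^ 3 else - v i * v j),
      v i, by simp, by simp; ring, fun j hj => by simp [hj]; ring⟩
  have hf : Function.Bijective f := by
    constructor
    · intro v w h
      have ha : ∀ j, _ := fun j => congrFun (congrArg (fun x => x.1.1) h) j
      have hb : ∀ j, _ := fun j => congrFun (congrArg (fun x => x.1.2) h) j
      simp only [f] at ha hb
      have hne : ∀ j, j ≠ i → v j = w j := fun j hj => by simpa [hj] using ha j
      have h1 : v i ^ 2 = w i ^ 2 := by
        have := ha i
        simp only [if_true] at this
        exact mul_left_cancel₀ (neg_ne_zero.2 h3) this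
      have h2 : v i ^ 3 = w i ^ 3 := by
        have := hb i
        simp only [if_true] at this
        exact mul_left_cancel₀ h2 this
      have h4 : v i = w i := by
        by_cases hw : w i = 0
        · rw [hw] at h1 ⊢
          simpa using h1
        · have : w i ^ 2 * (v i - w i) = 0 := by linear_combination h2 - v i * h1
          rcases mul_eq_zero.1 this with h | h
          · exact absurd (by simpa using h) hw
          · exact sub_eq_zero.1 h
      funext j
      by_cases hj : j = i
      · rw [hj, h4]
      · exact hne j hj
    · rintro ⟨⟨a, b⟩, x, hx1, hx2, hx3⟩
      refine ⟨fun j => if j = i then x else a j, Subtype.ext (Prod.ext ?_ ?_)⟩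
      · funext j
        by_cases hj : j = i
        · subst hj
          simp only [f, if_true]
          linear_combination -hx1
        · simp [f, hj]
      · funext j
        by_cases hj : j = i
        · subst hj
          simp only [f, if_true] at hx1 hx2 ⊢
          linear_combination x * hx1 - hx2
        · simp only [f, hj, if_true, if_false]
          linear_combination -hx3 j hj
  rw [← Nat.card_congr (Equiv.ofBijective f hf), Nat.card_fun, Nat.card_fin]

theorem card_not_singJet {κ : Type*} [Field κ] [Finite κ] (h2 : (2 : κ) ≠ 0)
    (h3 : (3 : κ) ≠ 0) (i : Fin 3) :
    (Nat.card {ab : (Fin 3 → κ) × (Fin 3 → κ) | ¬ SingJet i ab.1 ab.2} : ℝ) =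
      Nat.card ((Fin 3 → κ) × (Fin 3 → κ)) * (1 - ((Nat.card κ : ℝ) ^ 3)⁻¹) := by
  have h := Set.ncard_add_ncard_compl {ab : (Fin 3 → κ) × (Fin 3 → κ) | SingJet i ab.1 ab.2}
  rw [← Nat.card_coe_set_eq, card_singJet h2 h3 i, ← Nat.card_coe_set_eq] at h
  have h' : (Nat.card κ : ℝ) ^ 3 +
      Nat.card {ab : (Fin 3 → κ) × (Fin 3 → κ) | ¬ SingJet i ab.1 ab.2} =
      Nat.card ((Fin 3 → κ) × (Fin 3 → κ)) := by exact_mod_cast h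
  have hκ : (Nat.card κ : ℝ) ≠ 0 := by exact_mod_cast Nat.card_pos.ne'
  have h3 : (Nat.card ((Fin 3 → κ) × (Fin 3 → κ)) : ℝ) = (Nat.card κ : ℝ) ^ 6 := by
    rw [Nat.card_prod, Nat.card_fun, Nat.card_fin]
    push_cast
    ring
  rw [h3] at h' ⊢
  field_simp
  linear_combination h'

variable {K : Type*} [Field K] [Algebra F K]

omit [Fintype F] in
theorem aeval_smul_of_isHomogeneous {G : MvPolynomial (Fin 3) F} {n : ℕ} (hG : G.IsHomogeneous n)
    (c : K) (pt : Fin 3 → K) : aeval (c • pt) G = c ^ n * aeval pt G := by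
  rw [aeval_def, aeval_def, eval₂_eq', eval₂_eq', Finset.mul_sum]
  refine Finset.sum_congr rfl fun m hm => ?_
  have hdeg := hG (mem_support_iff.1 hm)
  rw [Finsupp.weight_apply, Finsupp.sum_fintype _ _ (by simp)] at hdeg
  simp only [Pi.one_apply, smul_eq_mul, mul_one] at hdeg
  simp only [Pi.smul_apply, smul_eq_mul, mul_pow, Finset.prod_mul_distrib,
    Finset.prod_pow_eq_pow_sum,
    hdeg]
  ring

variable {k : ℕ} {A B : MvPolynomial (Fin 3) F}

omit [Fintype F] in
theorem SingAt.smul (hA : A.IsHomogeneous (4 * k)) (hB : B.IsHomogeneous (6 * k))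
    (hk : k ≠ 0) {pt : Fin 3 → AlgebraicClosure F} (h : SingAt F A B pt) (c : AlgebraicClosure F) :
    SingAt F A B (c • pt) := by
  obtain ⟨x, y, h1, h2, h3, h4⟩ := h
  refine ⟨c ^ (2 * k) * x, c ^ (3 * k) * y, ?_, by linear_combination c ^ (3 * k) * h2, ?_,
    fun i => ?_⟩
  · rw [aeval_smul_of_isHomogeneous hA, aeval_smul_of_isHomogeneous hB]
    linear_combination c ^ (6 * k) * h1
  · rw [aeval_smul_of_isHomogeneous hA]
    linear_combination c ^ (4 * k) * h3
  · rw [aeval_smul_of_isHomogeneous hA.pderiv, aeval_smul_of_isHomogeneous hB.pderiv]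
    have : c ^ (6 * k - 1) = c ^ (4 * k - 1) * c ^ (2 * k) := by
      rw [← pow_add]
      congr 1
      have := Nat.pos_of_ne_zero hk
      omega
    rw [this]
    linear_combination c ^ (4 * k - 1) * c ^ (2 * k) * h4 i

omit [Fintype F] in
theorem exists_singAt_iff (hA : A.IsHomogeneous (4 * k)) (hB : B.IsHomogeneous (6 * k))
    (hk : k ≠ 0) :
    (∃ pt : Fin 3 → AlgebraicClosure F, pt ≠ 0 ∧ SingAt F A B pt) ↔
      ∃ pt : Fin 3 → AlgebraicClosure F, IsNormalized pt ∧ SingAt F A B pt := by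
  constructor
  · rintro ⟨pt, h0, h⟩
    obtain ⟨c, -, hc⟩ := exists_smul_isNormalized h0
    exact ⟨_, hc, h.smul hA hB hk c⟩
  · rintro ⟨pt, hn, h⟩
    refine ⟨pt, ?_, h⟩
    rintro rfl
    exact zero_ne_one hn

omit [Fintype F] in
theorem singAt_iff_singJet (hA : A.IsHomogeneous (4 * k)) (hB : B.IsHomogeneous (6 * k))
    (h2 : (2 : F) ≠ 0) {pt : Fin 3 → AlgebraicClosure F} (hn : IsNormalized pt) :
    SingAt F A B pt ↔ SingJet (chart pt) (jet pt A) (jet pt B) := by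
  have h2' : (2 : AlgebraicClosure F) ≠ 0 := by
    have := (map_ne_zero (algebraMap F (AlgebraicClosure F))).2 h2
    rwa [map_ofNat] at this
  have hj : ∀ G : MvPolynomial (Fin 3) F, ∀ j, j ≠ chart pt → jet pt G j = aeval pt (pderiv j G) :=
    fun G j hj => by simp [jet, hj]
  have hv : ∀ G : MvPolynomial (Fin 3) F, jet pt G (chart pt) = aeval pt G :=
    fun G => by simp [jet]
  constructor
  · rintro ⟨x, y, h1, hy, h3, h4⟩
    obtain rfl : y = 0 := (mul_eq_zero.1 hy).resolve_left h2'
    refine ⟨x, by rw [hv]; exact h3, ?_, fun j hne => by rw [hj _ _ hne, hj _ _ hne]; exact h4 j⟩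
    rw [hv, hv]
    linear_combination -h1
  · rintro ⟨x, h1, h3, h4⟩
    rw [hv] at h1 h3
    rw [hv] at h3
    refine ⟨x, 0, by linear_combination -h3, by simp, h1, fun j => ?_⟩
    by_cases hne : j = chart pt
    · have eA := congrArg (aeval pt) hA.sum_X_mul_pderiv
      have eB := congrArg (aeval pt) hB.sum_X_mul_pderiv
      rw [map_sum, map_nsmul] at eA eB
      simp only [map_mul, aeval_X, nsmul_eq_mul] at eA eB
      have hsum : ∑ l, pt l * (aeval pt (pderiv l A) * x + aeval pt (pderiv l B)) =
          aeval pt (pderiv j A) * x + aeval pt (pderiv j B) := by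
        rw [Finset.sum_eq_single j]
        · rw [hne, hn, one_mul]
        · intro l _ hl
          have := h4 l (hne ▸ hl)
          rw [hj _ _ (hne ▸ hl), hj _ _ (hne ▸ hl)] at this
          rw [this, mul_zero]
        · simp
      rw [← hsum]
      simp only [mul_add, Finset.sum_add_distrib, ← mul_assoc]
      rw [← Finset.sum_mul, eA, eB]
      push_cast
      linear_combination (6 * k : AlgebraicClosure F) * h3 - (2 * k : AlgebraicClosure F) * x * h1
    · have := h4 j hne
      rwa [hj _ _ hne, hj _ _ hne] at this

end SingularJets

section Density

variable (F) in
/-- The forms of degree `d` in three variables. -/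
abbrev Forms (d : ℕ) : Submodule F (MvPolynomial (Fin 3) F) := homogeneousSubmodule (Fin 3) F d

instance finite_forms (d : ℕ) : Finite (Forms F d) :=
  have : Module.Finite F (Forms F d) := Module.Finite.iff_fg.2 (homogeneousSubmodule_fg (Fin 3) F d)
  Module.finite_of_finite F

/-- Weierstrass pairs of level `k` as pairs of forms. -/
def wPairsEquiv (k : ℕ) (Q : MvPolynomial (Fin 3) F → MvPolynomial (Fin 3) F → Prop) :
    {AB ∈ WPairs F k | Q AB.1 AB.2} ≃ {v : Forms F (4 * k) × Forms F (6 * k) | Q v.1 v.2} where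
  toFun AB := ⟨(⟨AB.1.1, AB.2.1.1⟩, ⟨AB.1.2, AB.2.1.2⟩), AB.2.2⟩
  invFun v := ⟨(v.1.1.1, v.1.2.1), ⟨⟨v.1.1.2, v.1.2.2⟩, v.2⟩⟩
  left_inv _ := rfl
  right_inv _ := rfl

omit [Fintype F] in
theorem card_wPairs (k : ℕ) :
    Nat.card (WPairs F k) = Nat.card (Forms F (4 * k) × Forms F (6 * k)) := by
  have h := Nat.card_congr (wPairsEquiv (F := F) k fun _ _ => True)
  have h1 : {AB ∈ WPairs F k | True} = WPairs F k := by ext; simp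
  rw [h1] at h
  rw [h]
  exact Nat.card_congr (Equiv.subtypeUnivEquiv fun _ => trivial)

theorem finite_wPairs (k : ℕ) : (WPairs F k).Finite :=
  Nat.finite_of_card_ne_zero (by rw [card_wPairs]; exact Nat.card_pos.ne')

variable (F) in
/-- The fraction of the Weierstrass pairs of level `k` satisfying a property. -/
def wDensity (k : ℕ) (Q : MvPolynomial (Fin 3) F → MvPolynomial (Fin 3) F → Prop) : ℝ :=
  Nat.card {AB ∈ WPairs F k | Q AB.1 AB.2} / Nat.card (WPairs F k)

omit [Fintype F] in
theorem wDensity_eq (k : ℕ) (Q : MvPolynomial (Fin 3) F → MvPolynomial (Fin 3) F → Prop) :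
    wDensity F k Q = (Nat.card {v : Forms F (4 * k) × Forms F (6 * k) | Q v.1 v.2} : ℝ) /
      Nat.card (Forms F (4 * k) × Forms F (6 * k)) := by
  rw [wDensity, card_wPairs, Nat.card_congr (wPairsEquiv k Q)]

variable {k : ℕ} {Q Q' : MvPolynomial (Fin 3) F → MvPolynomial (Fin 3) F → Prop}

theorem wDensity_mono (h : ∀ A B : MvPolynomial (Fin 3) F, A.IsHomogeneous (4 * k) →
    B.IsHomogeneous (6 * k) → Q A B → Q' A B) : wDensity F k Q ≤ wDensity F k Q' := by
  unfold wDensity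
  gcongr
  exact Nat.card_mono ((finite_wPairs k).subset fun AB h => h.1)
    fun AB hAB => ⟨hAB.1, h _ _ hAB.1.1 hAB.1.2 hAB.2⟩

omit [Fintype F] in
theorem wDensity_or_le :
    wDensity F k (fun A B => Q A B ∨ Q' A B) ≤ wDensity F k Q + wDensity F k Q' := by
  simp only [wDensity_eq]
  rw [← add_div]
  gcongr
  norm_cast
  simp only [Nat.card_coe_set_eq]
  exact Set.ncard_union_le _ _

theorem wDensity_add_not : wDensity F k Q + wDensity F k (fun A B => ¬ Q A B) = 1 := by
  simp only [wDensity_eq]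
  rw [← add_div, div_eq_one_iff_eq (by exact_mod_cast Nat.card_pos.ne')]
  norm_cast
  rw [Nat.card_coe_set_eq, Nat.card_coe_set_eq]
  exact Set.ncard_add_ncard_compl _

theorem wDensity_exists_le {ι : Type*} (s : Finset ι)
    (R : ι → MvPolynomial (Fin 3) F → MvPolynomial (Fin 3) F → Prop) :
    wDensity F k (fun A B => ∃ i ∈ s, R i A B) ≤ ∑ i ∈ s, wDensity F k (R i) := by
  classical
  induction s using Finset.induction_on with
  | empty => simp [wDensity]
  | insert a s ha ih =>
    rw [Finset.sum_insert ha]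
    refine le_trans ?_ (wDensity_or_le.trans (add_le_add_right ih _))
    refine wDensity_mono fun A B _ _ h => ?_
    simpa using h

end Density

section Sieve

omit [Fintype F] in
theorem two_ne_zero_closure {K : Type*} [Field K] [Algebra F K] (h2 : (2 : F) ≠ 0) :
    (2 : K) ≠ 0 := by
  have := (map_ne_zero (algebraMap F K)).2 h2
  rwa [map_ofNat] at this

omit [Fintype F] in
theorem three_ne_zero_closure {K : Type*} [Field K] [Algebra F K] (h3 : (3 : F) ≠ 0) :
    (3 : K) ≠ 0 := by
  have := (map_ne_zero (algebraMap F K)).2 h3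
  rwa [map_ofNat] at this

variable {O : Finset (Fin 3 → AlgebraicClosure F)} {k : ℕ}

/-- The residue field of a geometric point. -/
abbrev residueField (P : Fin 3 → AlgebraicClosure F) : Subfield (AlgebraicClosure F) :=
  fixedSubfield F (AlgebraicClosure F) (ptDegree F P)

/-- The jets of a Weierstrass pair at a finite set of points. -/
def jetsHom (O : Finset (Fin 3 → AlgebraicClosure F)) (k : ℕ) :
    Forms F (4 * k) × Forms F (6 * k) →+
      ((P : O) → (Fin 3 → residueField P.1) × (Fin 3 → residueField P.1)) :=
  AddMonoidHom.mk' (fun v P => (fun j => ⟨jet P.1 v.1.1 j, jet_mem_fixedSubfield P.1 v.1.1 j⟩,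
    fun j => ⟨jet P.1 v.2.1 j, jet_mem_fixedSubfield P.1 v.2.1 j⟩)) (by
      intro v w
      funext P
      refine Prod.ext (_root_.funext fun j => Subtype.ext ?_)
          (_root_.funext fun j => Subtype.ext ?_)
      · exact congrFun (jet_add P.1 v.1.1 w.1.1) j
      · exact congrFun (jet_add P.1 v.2.1 w.2.1) j)

theorem jetsHom_surjective (hO : ∀ P ∈ O, IsNormalized P) (hind : OrbitIndependent F O)
    (hd : 2 * ∑ P ∈ O, ptDegree F P ≤ 4 * k + 1) : Function.Surjective (jetsHom O k) := by
  classical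
  intro w
  obtain ⟨A, hA, hA'⟩ := exists_jet_eq_over_base hO hind hd
    (fun P => if h : P ∈ O then fun j => ((w ⟨P, h⟩).1 j : AlgebraicClosure F) else 0)
    (fun P hP j => by simp only [hP, dif_pos]; exact ((w ⟨P, hP⟩).1 j).2)
  obtain ⟨B, hB, hB'⟩ := exists_jet_eq_over_base (d := 6 * k) hO hind (by omega)
    (fun P => if h : P ∈ O then fun j => ((w ⟨P, h⟩).2 j : AlgebraicClosure F) else 0)
    (fun P hP j => by simp only [hP, dif_pos]; exact ((w ⟨P, hP⟩).2 j).2)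
  refine ⟨(⟨A, hA⟩, ⟨B, hB⟩), _root_.funext fun P =>
    Prod.ext (_root_.funext fun j => Subtype.ext ?_)
    (_root_.funext fun j => Subtype.ext ?_)⟩
  · have := congrFun (hA' P.1 P.2) j
    rwa [dif_pos P.2] at this
  · have := congrFun (hB' P.1 P.2) j
    rwa [dif_pos P.2] at this

theorem card_residueField (P : Fin 3 → AlgebraicClosure F) :
    Nat.card (residueField P) = Fintype.card F ^ ptDegree F P :=
  card_fixedSubfield (ptDegree_pos P).ne'

instance finite_residueField (P : Fin 3 → AlgebraicClosure F) : Finite (residueField P) :=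
  Nat.finite_of_card_ne_zero (by rw [card_residueField]; exact pow_ne_zero _ Fintype.card_ne_zero)

theorem wDensity_forall_not_singAt (h2 : (2 : F) ≠ 0) (h3 : (3 : F) ≠ 0)
    (hO : ∀ P ∈ O, IsNormalized P) (hind : OrbitIndependent F O)
    (hd : 2 * ∑ P ∈ O, ptDegree F P ≤ 4 * k + 1) :
    wDensity F k (fun A B => ∀ P ∈ O, ¬ SingAt F A B P) =
      ∏ P ∈ O, (1 - ((Fintype.card F : ℝ) ^ (3 * ptDegree F P))⁻¹) := by
  have h2' : (2 : AlgebraicClosure F) ≠ 0 := two_ne_zero_closure h2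
  have h3' : (3 : AlgebraicClosure F) ≠ 0 := three_ne_zero_closure h3
  set T : Set ((P : O) → (Fin 3 → residueField P.1) × (Fin 3 → residueField P.1)) :=
    {w | ∀ P, ¬ SingJet (chart P.1) (w P).1 (w P).2} with hT
  have key := card_preimage_mul_card _ (jetsHom_surjective hO hind hd) T
  have hpre : {v : Forms F (4 * k) × Forms F (6 * k) | ∀ P ∈ O, ¬ SingAt F v.1 v.2 P} =
      jetsHom O k ⁻¹' T := by
    ext v
    simp only [Set.mem_ofPred_eq, Set.mem_preimage, hT, Subtype.forall]
    refine forall₂_congr fun P hP => not_congr ?_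
    rw [singAt_iff_singJet v.1.2 v.2.2 h2 (hO P hP)]
    exact singJet_coe_iff (κ := residueField P) h2' h3' (chart P)
      (jetsHom O k v ⟨P, hP⟩).1 (jetsHom O k v ⟨P, hP⟩).2
  have hTcard : (Nat.card T : ℝ) =
      Nat.card ((P : O) → (Fin 3 → residueField P.1) × (Fin 3 → residueField P.1)) *
        ∏ P ∈ O, (1 - ((Fintype.card F : ℝ) ^ (3 * ptDegree F P))⁻¹) := by
    have hTpi := Nat.card_congr (Equiv.subtypePiEquivPi (p := fun (P : O)
      (w : (Fin 3 → residueField P.1) × (Fin 3 → residueField P.1)) =>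
        ¬ SingJet (chart P.1) w.1 w.2))
    rw [Nat.card_pi] at hTpi
    rw [show Nat.card T = _ from hTpi, Nat.card_pi, ← Finset.prod_coe_sort O]
    push_cast
    rw [← Finset.prod_mul_distrib]
    refine Finset.prod_congr rfl fun P _ => ?_
    have h := card_not_singJet (κ := residueField P.1) (fun h => h2' (congrArg Subtype.val h))
      (fun h => h3' (congrArg Subtype.val h)) (chart P.1)
    rw [card_residueField] at h
    refine h.trans ?_
    rw [Nat.card_prod]
    push_cast
    rw [← pow_mul, mul_comm (ptDegree F P.1)]
  have hV : (Nat.card (Forms F (4 * k) × Forms F (6 * k)) : ℝ) ≠ 0 := by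
    exact_mod_cast Nat.card_pos.ne'
  have hW : (Nat.card ((P : O) → (Fin 3 → residueField P.1) ×
      (Fin 3 → residueField P.1)) : ℝ) ≠ 0 := by
    exact_mod_cast Nat.card_pos.ne'
  rw [wDensity_eq, hpre, div_eq_iff hV]
  have key' : (Nat.card (jetsHom O k ⁻¹' T) : ℝ) *
      Nat.card ((P : O) → (Fin 3 → residueField P.1) × (Fin 3 → residueField P.1)) =
      Nat.card T * Nat.card (Forms F (4 * k) × Forms F (6 * k)) := by exact_mod_cast key
  rw [hTcard] at key'
  refine mul_right_cancel₀ hW (key'.trans ?_)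
  ring

theorem wDensity_singAt (h2 : (2 : F) ≠ 0) (h3 : (3 : F) ≠ 0)
    {P : Fin 3 → AlgebraicClosure F} (hP : IsNormalized P) (hd : ptDegree F P ≤ k) :
    wDensity F k (fun A B => SingAt F A B P) = ((Fintype.card F : ℝ) ^ (3 * ptDegree F P))⁻¹ := by
  have h := wDensity_forall_not_singAt (O := {P}) (k := k) h2 h3 (by simpa using hP)
    (by intro a ha b hb _ _ _; rw [Finset.mem_singleton.1 ha, Finset.mem_singleton.1 hb])
    (by rw [Finset.sum_singleton]; omega)
  simp only [Finset.mem_singleton, forall_eq, Finset.prod_singleton] at h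
  have h' := wDensity_add_not (F := F) (k := k) (Q := fun A B => SingAt F A B P)
  rw [h] at h'
  linarith

theorem wDensity_exists_singAt_le (h2 : (2 : F) ≠ 0) (h3 : (3 : F) ≠ 0) (r k : ℕ) :
    wDensity F k (fun A B => ∃ P : Fin 3 → AlgebraicClosure F, IsNormalized P ∧
      r < ptDegree F P ∧ ptDegree F P ≤ k ∧ SingAt F A B P) ≤
      ∑ e ∈ Finset.Ioc r k, 3 * ((Fintype.card F : ℝ)⁻¹) ^ e := by
  have hq : (Fintype.card F : ℝ) ≠ 0 := by exact_mod_cast Fintype.card_ne_zero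
  refine le_trans (wDensity_mono (Q' := fun A B => ∃ e ∈ Finset.Ioc r k,
    ∃ P ∈ (finite_pointsOfDegree (F := F) (K := AlgebraicClosure F) e).toFinset,
        SingAt F A B P) ?_) ?_
  · rintro A B - - ⟨P, hP, hr, hk, h⟩
    exact ⟨_, Finset.mem_Ioc.2 ⟨hr, hk⟩, P, by simpa [pointsOfDegree] using hP, h⟩
  · refine (wDensity_exists_le _ _).trans (Finset.sum_le_sum fun e he => ?_)
    rw [Finset.mem_Ioc] at he
    refine (wDensity_exists_le _ _).trans ?_
    rw [Finset.sum_congr rfl (g := fun _ => ((Fintype.card F : ℝ) ^ (3 * e))⁻¹)]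
    · rw [Finset.sum_const, nsmul_eq_mul, ← Set.ncard_eq_toFinset_card _ (finite_pointsOfDegree e)]
      have h := card_pointsOfDegree_le (F := F) (K := AlgebraicClosure F) (n := e) (by omega)
      have h' : ((pointsOfDegree F (AlgebraicClosure F) e).ncard : ℝ) ≤
        3 * (Fintype.card F : ℝ) ^ (2 * e) := by exact_mod_cast h
      calc _ ≤ 3 * (Fintype.card F : ℝ) ^ (2 * e) * ((Fintype.card F : ℝ) ^ (3 * e))⁻¹ := by gcongr
        _ = _ := by
          rw [inv_pow]
          field_simp
          ring
    · intro P hP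
      rw [Set.Finite.mem_toFinset] at hP
      obtain ⟨hP, rfl⟩ := hP
      exact wDensity_singAt h2 h3 hP he.2

end Sieve

section Bivariate

open Polynomial.Bivariate in
theorem coeff_coeff_swap {R : Type*} [CommSemiring R] (f : Polynomial (Polynomial R)) (m n : ℕ) :
    ((swap f).coeff m).coeff n = (f.coeff n).coeff m := by
  induction f using Polynomial.induction_on' with
  | add f g hf hg => simp only [map_add, Polynomial.coeff_add, hf, hg]
  | monomial a f =>
    induction f using Polynomial.induction_on' with
    | add f g hf hg =>
      simp only [map_add, Polynomial.coeff_add, hf, hg]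
    | monomial b r =>
      rw [swap_monomial_monomial]
      simp only [Polynomial.coeff_monomial]
      split_ifs <;> simp_all [Polynomial.coeff_monomial]

open Polynomial.Bivariate in
theorem natDegree_coeff_le_natDegree_swap {R : Type*} [CommSemiring R]
    (f : Polynomial (Polynomial R)) (n : ℕ) :
    (f.coeff n).natDegree ≤ (swap f).natDegree := by
  rw [Polynomial.natDegree_le_iff_coeff_eq_zero]
  intro m hm
  rw [← coeff_coeff_swap, Polynomial.coeff_eq_zero_of_natDegree_lt hm, Polynomial.coeff_zero]

theorem natDegree_det_le {R : Type*} [CommRing R] {n N : ℕ}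
    (M : Matrix (Fin n) (Fin n) (Polynomial R)) (h : ∀ i j, (M i j).natDegree ≤ N) :
    M.det.natDegree ≤ n * N := by
  rw [Matrix.det_apply]
  refine Polynomial.natDegree_sum_le_of_forall_le _ _ fun σ _ => ?_
  refine (Polynomial.natDegree_smul_le _ _).trans ((Polynomial.natDegree_prod_le _ _).trans ?_)
  refine (Finset.sum_le_card_nsmul _ _ N fun i _ => h _ _).trans ?_
  simp

variable {κ K : Type*} [Field κ] [Field K] [Algebra κ K]

open Polynomial.Bivariate in
theorem natDegree_add_natDegree_swap_pos {π : Polynomial (Polynomial κ)} (hπ : Irreducible π) :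
    0 < π.natDegree + (swap π).natDegree := by
  by_contra! h
  obtain ⟨f, rfl⟩ := Polynomial.natDegree_eq_zero.1 (Nat.le_zero.1 ((Nat.le_add_right _ _).trans h))
  have h2 := natDegree_coeff_le_natDegree_swap (Polynomial.C f) 0
  rw [Polynomial.coeff_C_zero] at h2
  obtain ⟨a, rfl⟩ := Polynomial.natDegree_eq_zero.1
    (Nat.le_zero.1 (h2.trans ((Nat.le_add_left _ _).trans h)))
  by_cases ha : a = 0
  · simp [ha] at hπ
  · exact hπ.not_isUnit (((isUnit_iff_ne_zero.2 ha).map Polynomial.C).map Polynomial.C)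

open Polynomial.Bivariate in
theorem exists_eliminant {π R : Polynomial (Polynomial κ)} (hπ : Irreducible π) (hdvd : ¬ π ∣ R)
    {N : ℕ} (h1 : π.natDegree ≤ N) (h2 : (swap π).natDegree ≤ N) (h3 : R.natDegree ≤ N)
    (h4 : (swap R).natDegree ≤ N) :
    ∃ r : Polynomial κ, r ≠ 0 ∧ r.natDegree ≤ (2 * N + 1) * N ∧ ∀ s t : K,
      Polynomial.aevalAeval s t π = 0 → Polynomial.aevalAeval s t R = 0 →
        Polynomial.aeval s r = 0 := by
  by_cases h0 : π.natDegree = 0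
  · obtain ⟨f, rfl⟩ := Polynomial.natDegree_eq_zero.1 h0
    refine ⟨f, ?_, ?_, fun s t h _ => ?_⟩
    · rintro rfl
      exact hπ.ne_zero (by simp)
    · have := natDegree_coeff_le_natDegree_swap (Polynomial.C f) 0
      rw [Polynomial.coeff_C_zero] at this
      nlinarith
    · rwa [Polynomial.aevalAeval_C] at h
  · refine ⟨π.resultant R, ?_, ?_, fun s t hs ht => ?_⟩
    · have hprim := hπ.isPrimitive h0
      have hirr := (hprim.irreducible_iff_irreducible_map_fraction_map
        (K := FractionRing (Polynomial κ))).1 hπ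
      have hnd : ¬ π.map (algebraMap (Polynomial κ) (FractionRing (Polynomial κ))) ∣
          R.map (algebraMap (Polynomial κ) (FractionRing (Polynomial κ))) := fun h =>
        hdvd (hprim.dvd_of_fraction_map_dvd_fraction_map h)
      have hne := Polynomial.resultant_ne_zero _ _ (hirr.coprime_iff_not_dvd.2 hnd)
      have hinj := IsFractionRing.injective (Polynomial κ) (FractionRing (Polynomial κ))
      rw [Polynomial.natDegree_map_eq_of_injective hinj,
        Polynomial.natDegree_map_eq_of_injective hinj, Polynomial.resultant_map_map] at hne
      exact fun h => hne (by rw [h, map_zero])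
    · refine (natDegree_det_le (N := N) _ fun i j => ?_).trans (Nat.mul_le_mul_right _ (by omega))
      rw [Polynomial.sylvester, Matrix.of_apply]
      refine Fin.addCases (fun j => ?_) (fun j => ?_) j
      · simp only [Fin.addCases_left]
        split_ifs
        · exact (natDegree_coeff_le_natDegree_swap _ _).trans h4
        · simp
      · simp only [Fin.addCases_right]
        split_ifs
        · exact (natDegree_coeff_le_natDegree_swap _ _).trans h2
        · simp
    · obtain ⟨p, q, -, -, hpq⟩ :=
        Polynomial.exists_mul_add_mul_eq_C_resultant π R le_rfl le_rfl (Or.inl h0)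
      have := congrArg (Polynomial.aevalAeval s t) hpq
      rw [map_add, map_mul, map_mul, hs, ht, Polynomial.aevalAeval_C] at this
      simpa using this.symm

open Polynomial.Bivariate in
theorem exists_finset_common_zeros {π R : Polynomial (Polynomial κ)} (hπ : Irreducible π)
    (hdvd : ¬ π ∣ R) {N : ℕ} (h1 : π.natDegree ≤ N) (h2 : (swap π).natDegree ≤ N)
    (h3 : R.natDegree ≤ N) (h4 : (swap R).natDegree ≤ N) :
    ∃ Z : Finset (K × K), Z.card ≤ ((2 * N + 1) * N) ^ 2 ∧ ∀ s t : K,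
      Polynomial.aevalAeval s t π = 0 → Polynomial.aevalAeval s t R = 0 → (s, t) ∈ Z := by
  classical
  obtain ⟨r, hr, hrd, hrz⟩ := exists_eliminant (K := K) hπ hdvd h1 h2 h3 h4
  obtain ⟨r', hr', hrd', hrz'⟩ := exists_eliminant (K := K) (π := swap π) (R := swap R) (N := N)
    ((MulEquiv.irreducible_iff (swap : Polynomial (Polynomial κ) ≃ₐ[κ] _)).2 hπ)
    (fun h => hdvd ((map_dvd_iff (swap : Polynomial (Polynomial κ) ≃ₐ[κ] _)).1 h)) h2
    (by rwa [swap_swap_apply]) h4 (by rwa [swap_swap_apply])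
  have hcard : ∀ f : Polynomial κ, (f.map (algebraMap κ K)).roots.toFinset.card ≤ f.natDegree :=
    fun f => (Multiset.toFinset_card_le _).trans
      ((Polynomial.card_roots' _).trans Polynomial.natDegree_map_le)
  have hmem : ∀ f : Polynomial κ, f ≠ 0 → ∀ x : K, Polynomial.aeval x f = 0 →
      x ∈ (f.map (algebraMap κ K)).roots.toFinset := by
    intro f hf x hx
    rw [Multiset.mem_toFinset, Polynomial.mem_roots (Polynomial.map_ne_zero hf),
      Polynomial.IsRoot.def, Polynomial.eval_map_algebraMap, hx]
  refine ⟨(r.map (algebraMap κ K)).roots.toFinset ×ˢ (r'.map (algebraMap κ K)).roots.toFinset, ?_,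
    fun s t hs ht => ?_⟩
  · rw [Finset.card_product, sq]
    exact Nat.mul_le_mul ((hcard r).trans hrd) ((hcard r').trans hrd')
  · rw [Finset.mem_product]
    exact ⟨hmem r hr s (hrz s t hs ht), hmem r' hr' t (hrz' t s (by rwa [aevalAeval_swap])
      (by rwa [aevalAeval_swap]))⟩

open Polynomial.Bivariate UniqueFactorizationMonoid in
theorem card_factors_le {R : Polynomial (Polynomial κ)} (hR : R ≠ 0) {N : ℕ}
    (h1 : R.natDegree ≤ N) (h2 : (swap R).natDegree ≤ N) :
    Multiset.card (factors R) ≤ 2 * N := by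
  have hdeg : ∀ (s : Multiset (Polynomial (Polynomial κ))), (∀ π ∈ s, Irreducible π) →
      Multiset.card s ≤ s.prod.natDegree + (swap s.prod).natDegree := by
    intro s
    induction s using Multiset.induction_on with
    | empty => simp
    | cons π s ih =>
      intro h
      have hπ := h π (Multiset.mem_cons_self π s)
      have hs : s.prod ≠ 0 := Multiset.prod_ne_zero fun h0 =>
        (h 0 (Multiset.mem_cons_of_mem h0)).ne_zero rfl
      have ih' := ih fun π' h' => h π' (Multiset.mem_cons_of_mem h')
      have hpos := natDegree_add_natDegree_swap_pos hπ
      rw [Multiset.prod_cons, map_mul, Polynomial.natDegree_mul hπ.ne_zero hs,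
        Polynomial.natDegree_mul (by simpa using hπ.ne_zero) (by simpa using hs),
        Multiset.card_cons]
      omega
  have h := hdeg (factors R) fun π hπ => irreducible_of_factor π hπ
  have hassoc := factors_prod hR
  have h3 := Polynomial.natDegree_le_of_dvd hassoc.dvd hR
  have h4 : (swap (factors R).prod).natDegree ≤ (swap R).natDegree :=
    Polynomial.natDegree_le_of_dvd (map_dvd _ hassoc.dvd) (by simpa using hR)
  omega

end Bivariate

section Averaging

theorem card_mul_le_of_translates {V W : Type*} [AddCommGroup V] [Finite V] [Finite W] [Nonempty W]
    (φ : W → V) (T : Set V) (U c : ℕ)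
    (h : ∀ v, Nat.card {w | v + φ w ∈ T} * U ≤ c * Nat.card W) :
    Nat.card T * U ≤ c * Nat.card V := by
  classical
  have := Fintype.ofFinite V
  have e1 : Nat.card (Σ v : V, {w | v + φ w ∈ T}) = Nat.card T * Nat.card W := by
    rw [← Nat.card_prod]
    exact Nat.card_congr
      { toFun := fun x => (⟨x.1 + φ x.2.1, x.2.2⟩, x.2.1)
        invFun := fun y => ⟨y.1.1 - φ y.2, ⟨y.2, by simp [y.1.2]⟩⟩
        left_inv := fun x => by
          obtain ⟨v, w, hw⟩ := x
          have : v + φ w - φ w = v := by abel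
          simp only [Set.mem_ofPred_eq]
          congr 1
          congr! 1
          simp
        right_inv := fun y => by simp }
  rw [Nat.card_sigma] at e1
  have e2 : Nat.card T * Nat.card W * U ≤ Nat.card V * (c * Nat.card W) := by
    rw [← e1, Finset.sum_mul]
    refine (Finset.sum_le_card_nsmul _ _ _ fun v _ => h v).trans ?_
    simp [Nat.card_eq_fintype_card]
  have hW : 0 < Nat.card W := Nat.card_pos
  refine Nat.le_of_mul_le_mul_right (c := Nat.card W) ?_ hW
  calc _ = Nat.card T * Nat.card W * U := by ring
    _ ≤ _ := e2
    _ = _ := by ring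

theorem card_setOf_mul_le_of_card_fibers {X Y : Type*} [Finite X] [Finite Y] (P : X → Prop)
    (Q : X → Y → Prop) {U c₁ c₂ : ℕ} (h1 : Nat.card {x | P x} * U ≤ c₁ * Nat.card X)
    (h2 : ∀ x, ¬ P x → Nat.card {y | Q x y} * U ≤ c₂ * Nat.card Y) :
    Nat.card {z : X × Y | P z.1 ∨ Q z.1 z.2} * U ≤ (c₁ + c₂) * Nat.card (X × Y) := by
  classical
  have := Fintype.ofFinite X
  have e1 : Nat.card {z : X × Y | P z.1 ∨ Q z.1 z.2} ≤
      Nat.card {x | P x} * Nat.card Y + Nat.card {z : X × Y | ¬ P z.1 ∧ Q z.1 z.2} := by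
    have : {z : X × Y | P z.1 ∨ Q z.1 z.2} =
        {x | P x} ×ˢ Set.univ ∪ {z : X × Y | ¬ P z.1 ∧ Q z.1 z.2} := by
      ext z
      simp only [Set.mem_ofPred_eq, Set.mem_union, Set.mem_prod, Set.mem_univ]
      tauto
    rw [this, Nat.card_coe_set_eq]
    refine (Set.ncard_union_le _ _).trans_eq ?_
    rw [Set.ncard_prod, Set.ncard_univ, Nat.card_coe_set_eq, Nat.card_coe_set_eq]
  have e2 : Nat.card {z : X × Y | ¬ P z.1 ∧ Q z.1 z.2} * U ≤ Nat.card X * (c₂ * Nat.card Y) := by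
    have : Nat.card {z : X × Y | ¬ P z.1 ∧ Q z.1 z.2} =
        Nat.card (Σ x : X, {y | ¬ P x ∧ Q x y}) := Nat.card_congr
      { toFun := fun z => ⟨z.1.1, z.1.2, z.2⟩
        invFun := fun z => ⟨(z.1, z.2.1), z.2.2⟩
        left_inv := fun _ => rfl
        right_inv := fun _ => rfl }
    rw [this, Nat.card_sigma, Finset.sum_mul]
    refine (Finset.sum_le_card_nsmul _ _ (c₂ * Nat.card Y) fun x _ => ?_).trans_eq
      (by simp [Nat.card_eq_fintype_card])
    by_cases hx : P x
    · simp [hx]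
    · simpa [hx] using h2 x hx
  calc _ ≤ (Nat.card {x | P x} * Nat.card Y + Nat.card {z : X × Y | ¬ P z.1 ∧ Q z.1 z.2}) * U :=
        Nat.mul_le_mul_right _ e1
    _ = (Nat.card {x | P x} * U) * Nat.card Y +
        Nat.card {z : X × Y | ¬ P z.1 ∧ Q z.1 z.2} * U := by ring
    _ ≤ c₁ * Nat.card X * Nat.card Y + Nat.card X * (c₂ * Nat.card Y) :=
        add_le_add (Nat.mul_le_mul_right _ h1) e2
    _ = _ := by rw [Nat.card_prod]; ring

theorem card_exists_mul_le {ι X : Type*} [Finite X] (s : Finset ι) (P : ι → X → Prop) {U c : ℕ}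
    (h : ∀ a ∈ s, Nat.card {x | P a x} * U ≤ c * Nat.card X) :
    Nat.card {x | ∃ a ∈ s, P a x} * U ≤ s.card * c * Nat.card X := by
  classical
  have : {x | ∃ a ∈ s, P a x} = ⋃ a ∈ s, {x | P a x} := by ext; simp
  rw [this, Nat.card_coe_set_eq]
  refine (Nat.mul_le_mul_right _ (Finset.set_ncard_biUnion_le s _)).trans ?_
  rw [Finset.sum_mul]
  refine (Finset.sum_le_card_nsmul s _ (c * Nat.card X) fun a ha => ?_).trans_eq ?_
  · simpa only [Nat.card_coe_set_eq] using h a ha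
  · simp [mul_assoc]

theorem card_square_shift_mul_le {R : Type*} [CommRing R] [IsDomain R] [Algebra F R] (p : ℕ)
    [Fact p.Prime] [CharP R p] (Θ : MvPolynomial (Fin 3) F →ₐ[F] R) {i v : Fin 3}
    (hi : Θ (X i) = 1) {D : ℕ}
    (hv : ∀ f : Polynomial F, f.natDegree ≤ D → Polynomial.aeval (Θ (X v)) f = 0 → f = 0)
    (u w : R) :
    Nat.card {g : Forms F D | (u + Θ g ^ p) ^ 2 = w} * Fintype.card F ^ (D + 1) ≤
      2 * Nat.card (Forms F D) := by
  have hU : Nat.card (Polynomial.degreeLT F (D + 1)) = Fintype.card F ^ (D + 1) := by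
    rw [Nat.card_congr (Polynomial.degreeLTEquiv F (D + 1)).toEquiv, Nat.card_fun]
    simp [Nat.card_eq_fintype_card]
  rw [← hU]
  refine card_square_fiber_mul_le p (Θ.toLinearMap ∘ₗ (Forms F D).subtype).toAddMonoidHom
    (fun f : Polynomial.degreeLT F (D + 1) => ⟨∑ a ∈ Finset.range (D + 1),
      C (f.1.coeff a) * (X v ^ a * X i ^ (D - a)), ?_⟩) ?_ u w
  · refine Submodule.sum_mem _ fun a ha => ?_
    rw [mem_homogeneousSubmodule]
    have h1 := ((isHomogeneous_X F v).pow a).mul ((isHomogeneous_X F i).pow (D - a))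
    have h2 := (isHomogeneous_C (Fin 3) (f.1.coeff a)).mul h1
    have h3 := Finset.mem_range.1 ha
    convert h2 using 1
    omega
  · have hval : ∀ f : Polynomial.degreeLT F (D + 1), Θ (∑ a ∈ Finset.range (D + 1),
        C (f.1.coeff a) * (X v ^ a * X i ^ (D - a))) = Polynomial.aeval (Θ (X v)) f.1 := by
      intro f
      rw [Polynomial.aeval_eq_sum_range' (n := D + 1)]
      · simp only [map_sum, map_mul, map_pow, hi, one_pow, mul_one]
        refine Finset.sum_congr rfl fun a _ => ?_
        rw [Algebra.smul_def, ← MvPolynomial.algebraMap_eq, Θ.commutes]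
      · have := Polynomial.mem_degreeLT.1 f.2
        by_cases h0 : f.1 = 0
        · rw [h0]; simp
        · exact (Polynomial.natDegree_lt_iff_degree_lt h0).2 this
    intro f f' h
    replace h := ((hval f).symm.trans h).trans (hval f')
    rw [← sub_eq_zero, ← map_sub] at h
    have h2 := (f - f').2
    have h3 : ((f - f' : Polynomial.degreeLT F (D + 1)) : Polynomial F).natDegree ≤ D := by
      by_cases h0 : ((f - f' : Polynomial.degreeLT F (D + 1)) : Polynomial F) = 0
      · rw [h0]; simp
      · exact Nat.lt_succ_iff.1 ((Polynomial.natDegree_lt_iff_degree_lt h0).2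
          (Polynomial.mem_degreeLT.1 h2))
    exact Subtype.ext (sub_eq_zero.1 (hv _ h3 h))

end Averaging

section Dehomogenization

theorem ptDegree_le_mul_of_roots {K : Type*} [Field K] [Algebra F K] {i j l : Fin 3}
    (hcov : ∀ v, v = i ∨ v = j ∨ v = l) {pt : Fin 3 → K} (hi : pt i = 1) {D : ℕ}
    {f g : Polynomial F} (hf : f ≠ 0) (hfD : f.natDegree ≤ D) (hf0 : Polynomial.aeval (pt j) f = 0)
    (hg : g ≠ 0) (hgD : g.natDegree ≤ D) (hg0 : Polynomial.aeval (pt l) g = 0) :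
    ptDegree F pt ≤ D * D := by
  have h1 : IsIntegral F (pt j) := (IsAlgebraic.isIntegral ⟨f, hf, hf0⟩)
  have h2 : IsIntegral F (pt l) := (IsAlgebraic.isIntegral ⟨g, hg, hg0⟩)
  have d1 := (Polynomial.natDegree_le_of_dvd (minpoly.dvd F _ hf0) hf).trans hfD
  have d2 := (Polynomial.natDegree_le_of_dvd (minpoly.dvd F _ hg0) hg).trans hgD
  have p1 := minpoly.natDegree_pos h1
  have p2 := minpoly.natDegree_pos h2
  refine le_trans (Function.IsPeriodicPt.minimalPeriod_le (Nat.mul_pos p1 p2) ?_)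
    (Nat.mul_le_mul d1 d2)
  rw [Function.IsPeriodicPt, Function.IsFixedPt, ptFrob_iterate]
  funext v
  rcases hcov v with rfl | rfl | rfl
  · rw [hi, one_pow]
  · exact pow_pow_mul_eq_self (pow_card_pow_natDegree_minpoly h1) _
  · rw [mul_comm]
    exact pow_pow_mul_eq_self (pow_card_pow_natDegree_minpoly h2) _

variable (F) in
/-- Dehomogenization in an affine chart, with affine coordinates the variables `j` and `l`. -/
def dehom (j l : Fin 3) : MvPolynomial (Fin 3) F →ₐ[F] Polynomial (Polynomial F) :=
  aeval fun v => if v = j then Polynomial.C Polynomial.X else if v = l then Polynomial.X else 1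

omit [Fintype F] in
theorem dehom_X (j l v : Fin 3) : dehom F j l (X v) =
    if v = j then Polynomial.C Polynomial.X else if v = l then Polynomial.X else 1 := by
  simp [dehom]

omit [Fintype F] in
theorem natDegree_dehom_le (j l : Fin 3) {G : MvPolynomial (Fin 3) F} {n : ℕ}
    (hG : G.totalDegree ≤ n) : (dehom F j l G).natDegree ≤ n := by
  have h := aeval_natDegree_le (map (algebraMap F (Polynomial F)) G) (m := n) (n := 1)
    ((Finset.sup_mono (support_map_subset _ _)).trans hG)
    (fun v => if v = j then Polynomial.C Polynomial.X else if v = l then Polynomial.X else 1)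
    (fun v => by split_ifs <;> simp)
  rwa [aeval_map_algebraMap, mul_one] at h

omit [Fintype F] in
open Polynomial.Bivariate in
theorem swap_dehom {j l : Fin 3} (h : j ≠ l) (G : MvPolynomial (Fin 3) F) :
    swap (dehom F j l G) = dehom F l j G := by
  have : (swap : Polynomial (Polynomial F) ≃ₐ[F] _).toAlgHom.comp (dehom F j l) = dehom F l j := by
    ext v : 1
    simp only [AlgHom.comp_apply, dehom_X]
    by_cases hvj : v = j
    · subst hvj
      simp only [if_true, h, if_false]
      exact swap_X
    · by_cases hvl : v = l
      · subst hvl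
        simp only [if_true, hvj, if_false]
        exact swap_Y
      · simp [hvj, hvl]
  exact DFunLike.congr_fun this G

omit [Fintype F] in
theorem aevalAeval_dehom {K : Type*} [Field K] [Algebra F K] {i j l : Fin 3}
    (hcov : ∀ v, v = i ∨ v = j ∨ v = l) (hij : i ≠ j) (hil : i ≠ l) (hjl : j ≠ l) {pt : Fin 3 → K}
    (hi : pt i = 1) (G : MvPolynomial (Fin 3) F) :
    Polynomial.aevalAeval (pt j) (pt l) (dehom F j l G) = aeval pt G := by
  have : (Polynomial.aevalAeval (pt j) (pt l)).comp (dehom F j l) = aeval pt := by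
    ext v : 1
    simp only [AlgHom.comp_apply, dehom_X]
    rcases hcov v with rfl | rfl | rfl
    · simp [hij, hil, hi]
    · simp
    · simp [hjl.symm]
  exact DFunLike.congr_fun this G

theorem card_square_zero_mul_le {R : Type*} [CommRing R] [IsDomain R] [Algebra F R] (p : ℕ)
    [Fact p.Prime] [CharP F p] (Θ : MvPolynomial (Fin 3) F →ₐ[F] R) {i v : Fin 3}
    (hi : Θ (X i) = 1) {D : ℕ}
    (hv : ∀ f : Polynomial F, f.natDegree ≤ D → Polynomial.aeval (Θ (X v)) f = 0 → f = 0)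
    {a : F} (ha : a ≠ 0) (e : ℕ) (G H : MvPolynomial (Fin 3) F) :
    Nat.card {g : Forms F D | Θ (C a * (G + g.1 ^ p * X i ^ e) ^ 2 + H) = 0} *
      Fintype.card F ^ (D + 1) ≤ 2 * Nat.card (Forms F D) := by
  have : CharP R p := charP_of_injective_algebraMap (algebraMap F R).injective p
  have key := card_square_shift_mul_le p Θ hi hv (Θ G) (- (algebraMap F R a⁻¹ * Θ H))
  convert key using 6 with g
  have hC : Θ (C a) = algebraMap F R a := Θ.commutes a
  have hinv : algebraMap F R a⁻¹ * algebraMap F R a = 1 := by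
    rw [← map_mul, inv_mul_cancel₀ ha, map_one]
  simp only [map_add, map_mul, map_pow, hi, one_pow, mul_one, hC]
  constructor <;> intro h
  · linear_combination algebraMap F R a⁻¹ * h - (Θ G + Θ g ^ p) ^ 2 * hinv
  · linear_combination algebraMap F R a * h - Θ H * hinv

omit [Fintype F] in
theorem aeval_dehom_X_left (j l : Fin 3) (f : Polynomial F) :
    Polynomial.aeval (dehom F j l (X j)) f = Polynomial.C f := by
  rw [dehom_X, if_pos rfl, ← Polynomial.CAlgHom_apply (R := F), Polynomial.aeval_algHom_apply,
    Polynomial.aeval_X_left_apply]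
  rfl

open Polynomial.Bivariate in
omit [Fintype F] in
theorem aeval_dehom_X_right {j l : Fin 3} (hjl : j ≠ l) (f : Polynomial F) :
    Polynomial.aeval (dehom F j l (X l)) f = swap (Polynomial.C f) := by
  rw [← aeval_dehom_X_left l j, ← swap_dehom hjl.symm]
  exact Polynomial.aeval_algHom_apply (swap : Polynomial (Polynomial F) ≃ₐ[F] _).toAlgHom _ _

theorem card_dehom_eq_zero_mul_le (p : ℕ) [Fact p.Prime] [CharP F p] {i j : Fin 3} (l : Fin 3)
    (hij : i ≠ j) (hil : i ≠ l) {D : ℕ} {a : F} (ha : a ≠ 0) (e : ℕ)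
    (G H : MvPolynomial (Fin 3) F) :
    Nat.card {g : Forms F D | dehom F j l (C a * (G + g.1 ^ p * X i ^ e) ^ 2 + H) = 0} *
      Fintype.card F ^ (D + 1) ≤ 2 * Nat.card (Forms F D) := by
  refine card_square_zero_mul_le p (dehom F j l) (v := j) (by simp [dehom_X, hij, hil])
    (fun f _ hf => ?_) ha e G H
  rwa [aeval_dehom_X_left, Polynomial.C_eq_zero] at hf

theorem exists_algHom_eq_zero_iff_dvd.{u, v} (k : Type u) {S : Type v} [CommRing k] [CommRing S]
    [Algebra k S] {π : S} (hπ : Prime π) : ∃ (R : Type v) (_ : CommRing R) (_ : IsDomain R)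
    (_ : Algebra k R) (mk : S →ₐ[k] R), ∀ f, mk f = 0 ↔ π ∣ f := by
  have : (Ideal.span {π}).IsPrime := (Ideal.span_singleton_prime hπ.ne_zero).2 hπ
  refine ⟨S ⧸ Ideal.span {π}, inferInstance, inferInstance, inferInstance,
    Ideal.Quotient.mkₐ k (Ideal.span {π}), fun f => ?_⟩
  rw [Ideal.Quotient.mkₐ_eq_mk, Ideal.Quotient.eq_zero_iff_mem, Ideal.mem_span_singleton]

open Polynomial.Bivariate in
theorem card_dvd_dehom_mul_le (p : ℕ) [Fact p.Prime] [CharP F p] {i j l : Fin 3}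
    (hij : i ≠ j) (hil : i ≠ l) (hjl : j ≠ l) {D : ℕ} {a : F} (ha : a ≠ 0) (e : ℕ)
    (G H : MvPolynomial (Fin 3) F) {π : Polynomial (Polynomial F)} (hπ : Irreducible π) :
    Nat.card {g : Forms F D | π ∣ dehom F j l (C a * (G + g.1 ^ p * X i ^ e) ^ 2 + H)} *
      Fintype.card F ^ (D + 1) ≤ 2 * Nat.card (Forms F D) := by
  obtain ⟨R, _, _, _, mk, hmk0⟩ := exists_algHom_eq_zero_iff_dvd F hπ.prime
  have hi : (mk.comp (dehom F j l)) (X i) = 1 := by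
    simp [dehom_X, hij, hil]
  have hX : ∀ v f, Polynomial.aeval ((mk.comp (dehom F j l)) (X v)) f = 0 ↔
      π ∣ Polynomial.aeval (dehom F j l (X v)) f := fun v f => by
    rw [← hmk0, AlgHom.comp_apply, Polynomial.aeval_algHom_apply]
  have hdeg : ∀ (ρ : Polynomial (Polynomial F)) (f : Polynomial F), ρ.natDegree ≠ 0 →
      ρ ∣ Polynomial.C f → f = 0 := fun ρ f hρ h => by
    by_contra hf
    have := Polynomial.natDegree_le_of_dvd h (by simpa using hf)
    rw [Polynomial.natDegree_C] at this
    omega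
  have hpos := natDegree_add_natDegree_swap_pos hπ
  have key : ∃ v, ∀ f : Polynomial F, f.natDegree ≤ D →
      Polynomial.aeval ((mk.comp (dehom F j l)) (X v)) f = 0 → f = 0 := by
    by_cases h0 : π.natDegree = 0
    · refine ⟨l, fun f _ hf => hdeg (swap π) f (by omega) ?_⟩
      rw [hX, aeval_dehom_X_right hjl] at hf
      have := map_dvd (swap : Polynomial (Polynomial F) ≃ₐ[F] _) hf
      rwa [swap_swap_apply] at this
    · refine ⟨j, fun f _ hf => hdeg π f h0 ?_⟩
      rwa [hX, aeval_dehom_X_left] at hf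
  obtain ⟨v, hv⟩ := key
  have := card_square_zero_mul_le p (mk.comp (dehom F j l)) hi hv ha e G H
  simpa only [AlgHom.comp_apply, hmk0] using this

theorem card_aeval_eq_zero_mul_le {K : Type*} [Field K] [Algebra F K] (p : ℕ) [Fact p.Prime]
    [CharP F p] {i j l : Fin 3} (hcov : ∀ v, v = i ∨ v = j ∨ v = l) {pt : Fin 3 → K}
    (hi : pt i = 1) {D : ℕ} (hD : D * D < ptDegree F pt) {a : F} (ha : a ≠ 0) (e : ℕ)
    (G H : MvPolynomial (Fin 3) F) :
    Nat.card {g : Forms F D | aeval pt (C a * (G + g.1 ^ p * X i ^ e) ^ 2 + H) = 0} *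
      Fintype.card F ^ (D + 1) ≤ 2 * Nat.card (Forms F D) := by
  have key : ∃ v, ∀ f : Polynomial F, f.natDegree ≤ D →
      Polynomial.aeval (aeval pt (X v : MvPolynomial (Fin 3) F)) f = 0 → f = 0 := by
    by_contra! hcon
    obtain ⟨f, hfD, hf0, hf⟩ := hcon j
    obtain ⟨g, hgD, hg0, hg⟩ := hcon l
    rw [aeval_X] at hf0 hg0
    exact absurd (ptDegree_le_mul_of_roots hcov hi hf hfD hf0 hg hgD hg0) (not_le.2 hD)
  obtain ⟨v, hv⟩ := key
  exact card_square_zero_mul_le p (aeval pt) (by simp [hi]) hv ha e G H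

end Dehomogenization

section ChartBound

open Polynomial.Bivariate UniqueFactorizationMonoid in
theorem exists_finset_common_zeros_of_factors {κ K : Type*} [Field κ] [Field K] [Algebra κ K]
    {R₁ R₂ : Polynomial (Polynomial κ)} (h0 : R₁ ≠ 0) (hdvd : ∀ π ∈ factors R₁, ¬ π ∣ R₂) {N : ℕ}
    (h1 : R₁.natDegree ≤ N) (h2 : (swap R₁).natDegree ≤ N) (h3 : R₂.natDegree ≤ N)
    (h4 : (swap R₂).natDegree ≤ N) :
    ∃ Z : Finset (K × K), Z.card ≤ 2 * N * ((2 * N + 1) * N) ^ 2 ∧ ∀ s t : K,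
      Polynomial.aevalAeval s t R₁ = 0 → Polynomial.aevalAeval s t R₂ = 0 → (s, t) ∈ Z := by
  classical
  have key : ∀ π ∈ factors R₁, ∃ Z : Finset (K × K), Z.card ≤ ((2 * N + 1) * N) ^ 2 ∧ ∀ s t : K,
      Polynomial.aevalAeval s t π = 0 → Polynomial.aevalAeval s t R₂ = 0 → (s, t) ∈ Z := by
    intro π hπ
    have hd := dvd_of_mem_factors hπ
    exact exists_finset_common_zeros (irreducible_of_factor π hπ) (hdvd π hπ)
      ((Polynomial.natDegree_le_of_dvd hd h0).trans h1)
      ((Polynomial.natDegree_le_of_dvd (map_dvd swap hd) (by simpa using h0)).trans h2) h3 h4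
  choose! Z hZ hZ' using key
  refine ⟨(factors R₁).toFinset.biUnion Z, ?_, fun s t hs ht => ?_⟩
  · refine (Finset.card_biUnion_le_card_mul _ _ _
      fun π hπ => hZ π (Multiset.mem_toFinset.1 hπ)).trans
      (Nat.mul_le_mul_right _ ((Multiset.toFinset_card_le _).trans (card_factors_le h0 h1 h2)))
  · have hprod : Polynomial.aevalAeval s t (factors R₁).prod = 0 := by
      obtain ⟨u, hu⟩ := (factors_prod h0).symm
      rw [← hu, map_mul, hs, zero_mul]
    rw [map_multiset_prod, Multiset.prod_eq_zero_iff, Multiset.mem_map] at hprod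
    obtain ⟨π, hπ, h⟩ := hprod
    exact Finset.mem_biUnion.2 ⟨π, Multiset.mem_toFinset.2 hπ, hZ' π hπ s t h ht⟩

omit [Fintype F] in
theorem totalDegree_square_add_le {k : ℕ} (a : F) {G A H : MvPolynomial (Fin 3) F}
    (hG : G.IsHomogeneous (6 * k - 1)) (hA : A.IsHomogeneous (4 * k))
    (hH : H.IsHomogeneous (4 * k - 1)) : (C a * G ^ 2 + A * H ^ 2).totalDegree ≤ 12 * k := by
  refine (totalDegree_add _ _).trans (max_le ?_ ?_)
  · refine ((isHomogeneous_C _ a).mul (hG.pow 2)).totalDegree_le.trans (by omega)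
  · exact (hA.mul (hH.pow 2)).totalDegree_le.trans (by omega)

open UniqueFactorizationMonoid in
theorem card_high_degree_chart_mul_le {K : Type*} [Field K] [Algebra F K] (p : ℕ) [Fact p.Prime]
    [CharP F p] (h3 : (3 : F) ≠ 0) {i j l : Fin 3} (hcov : ∀ v, v = i ∨ v = j ∨ v = l)
    (hij : i ≠ j) (hil : i ≠ l) (hjl : j ≠ l) {k D c : ℕ} (hk : 6 * k = D * p + (c + 1)) :
    Nat.card {v : Forms F (4 * k) × Forms F (6 * k) | ∃ pt : Fin 3 → K, pt i = 1 ∧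
      D * D < ptDegree F pt ∧
      aeval pt (C 3 * pderiv j v.2.1 ^ 2 + v.1.1 * pderiv j v.1.1 ^ 2) = 0 ∧
      aeval pt (C 3 * pderiv l v.2.1 ^ 2 + v.1.1 * pderiv l v.1.1 ^ 2) = 0 ∧
      aeval pt (C 27 * v.2.1 ^ 2 + 4 * v.1.1 ^ 3) = 0} * Fintype.card F ^ (D + 1) ≤
    (2 + (2 * (12 * k) * 2 + 2 * (12 * k) * ((2 * (12 * k) + 1) * (12 * k)) ^ 2 * 2)) *
      Nat.card (Forms F (4 * k) × Forms F (6 * k)) := by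
  classical
  have h27 : (27 : F) ≠ 0 := by
    have : (27 : F) = 3 ^ 3 := by norm_num
    rw [this]; exact pow_ne_zero _ h3
  have hpow : ∀ (g : Forms F D), (g.1 ^ p * X i ^ c).IsHomogeneous (6 * k - 1) := fun g => by
    convert (IsHomogeneous.pow g.2 p).mul ((isHomogeneous_X F i).pow c) using 1
    omega
  have hpow1 : ∀ (g : Forms F D) v, (g.1 ^ p * (X v * X i ^ c)).IsHomogeneous (6 * k) :=
      fun g v => by
    convert (IsHomogeneous.pow g.2 p).mul ((isHomogeneous_X F v).mul ((isHomogeneous_X F i).pow c))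
      using 1
    omega
  let φ : Forms F D × (Forms F D × Forms F D) → Forms F (4 * k) × Forms F (6 * k) := fun w =>
    (0, ⟨w.1.1 ^ p * (X j * X i ^ c) + w.2.1.1 ^ p * (X l * X i ^ c) +
      w.2.2.1 ^ p * (X i * X i ^ c), ((hpow1 _ _).add (hpow1 _ _)).add (hpow1 _ _)⟩)
  refine card_mul_le_of_translates φ _ _ _ fun v => ?_
  obtain ⟨⟨A, hA⟩, ⟨B, hB⟩⟩ := v
  let S₁ : Forms F D → MvPolynomial (Fin 3) F := fun g =>
    C 3 * (pderiv j B + g.1 ^ p * X i ^ c) ^ 2 + A * pderiv j A ^ 2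
  let S₂ : Forms F D → MvPolynomial (Fin 3) F := fun g =>
    C 3 * (pderiv l B + g.1 ^ p * X i ^ c) ^ 2 + A * pderiv l A ^ 2
  let S₃ : Forms F D → Forms F D → Forms F D → MvPolynomial (Fin 3) F := fun g g' h =>
    C 27 * ((B + g.1 ^ p * (X j * X i ^ c) + g'.1 ^ p * (X l * X i ^ c)) +
      h.1 ^ p * X i ^ (c + 1)) ^ 2 + 4 * A ^ 3
  let P₁ : Forms F D → Prop := fun g => dehom F j l (S₁ g) = 0
  let P₂ : Forms F D → Forms F D → Prop := fun g g' =>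
    ∃ π ∈ (factors (dehom F j l (S₁ g))).toFinset, π ∣ dehom F j l (S₂ g')
  let Q : Forms F D → Forms F D → Forms F D → Prop := fun g g' h =>
    ∃ pt : Fin 3 → K, pt i = 1 ∧ D * D < ptDegree F pt ∧ aeval pt (S₁ g) = 0 ∧
      aeval pt (S₂ g') = 0 ∧ aeval pt (S₃ g g' h) = 0
  let Q₁ : Forms F D → Forms F D × Forms F D → Prop := fun g z => P₂ g z.1 ∨ Q g z.1 z.2
  have hdeg₁ : ∀ g, (S₁ g).totalDegree ≤ 12 * k := fun g =>
    totalDegree_square_add_le 3 ((IsHomogeneous.pderiv hB).add (hpow g)) hA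
        (IsHomogeneous.pderiv hA)
  have hdeg₂ : ∀ g, (S₂ g).totalDegree ≤ 12 * k := fun g =>
    totalDegree_square_add_le 3 ((IsHomogeneous.pderiv hB).add (hpow g)) hA
        (IsHomogeneous.pderiv hA)
  have hsub : {w | ((⟨A, hA⟩, ⟨B, hB⟩) : Forms F (4 * k) × Forms F (6 * k)) + φ w ∈
      {v : Forms F (4 * k) × Forms F (6 * k) | ∃ pt : Fin 3 → K, pt i = 1 ∧
        D * D < ptDegree F pt ∧
        aeval pt (C 3 * pderiv j v.2.1 ^ 2 + v.1.1 * pderiv j v.1.1 ^ 2) = 0 ∧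
        aeval pt (C 3 * pderiv l v.2.1 ^ 2 + v.1.1 * pderiv l v.1.1 ^ 2) = 0 ∧
        aeval pt (C 27 * v.2.1 ^ 2 + 4 * v.1.1 ^ 3) = 0}} ⊆
      {w | P₁ w.1 ∨ Q₁ w.1 w.2} := by
    rintro ⟨g, g', h⟩ ⟨pt, hpt, hd, e1, e2, e3⟩
    refine Or.inr (Or.inr ⟨pt, hpt, hd, ?_, ?_, ?_⟩)
    · convert e1 using 2
      simp [φ, S₁, pderiv_X, hij, hjl.symm]
    · convert e2 using 2
      simp [φ, S₂, pderiv_X, hjl, hil]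
    · convert e3 using 2
      simp only [φ, S₃, Prod.fst_add, Prod.snd_add, Submodule.coe_add, add_zero]
      ring
  refine (Nat.mul_le_mul_right _ (Nat.card_mono (Set.toFinite _) hsub)).trans ?_
  refine card_setOf_mul_le_of_card_fibers P₁ Q₁
    (card_dehom_eq_zero_mul_le p l hij hil h3 c _ _) fun g hg => ?_
  refine card_setOf_mul_le_of_card_fibers (P₂ g) (Q g) ?_ fun g' hg' => ?_
  · refine (card_exists_mul_le (c := 2) _ _ fun π hπ => card_dvd_dehom_mul_le p hij hil hjl h3 c _ _
      (irreducible_of_factor π (Multiset.mem_toFinset.1 hπ))).trans ?_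
    gcongr
    refine (Multiset.toFinset_card_le _).trans
      (card_factors_le hg (natDegree_dehom_le _ _ (hdeg₁ g)) ?_)
    rw [swap_dehom hjl]
    exact natDegree_dehom_le _ _ (hdeg₁ g)
  · obtain ⟨Z, hZ, hZ'⟩ := exists_finset_common_zeros_of_factors (K := K) (N := 12 * k) hg
      (fun π hπ hdvd => hg' ⟨π, Multiset.mem_toFinset.2 hπ, hdvd⟩)
      (natDegree_dehom_le _ _ (hdeg₁ g))
      (by rw [swap_dehom hjl]; exact natDegree_dehom_le _ _ (hdeg₁ g))
      (natDegree_dehom_le _ _ (hdeg₂ g'))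
      (by rw [swap_dehom hjl]; exact natDegree_dehom_le _ _ (hdeg₂ g'))
    let pt : K × K → Fin 3 → K := fun z v => if v = j then z.1 else if v = l then z.2 else 1
    have hsub' : {h | Q g g' h} ⊆
        {h | ∃ z ∈ Z, D * D < ptDegree F (pt z) ∧ aeval (pt z) (S₃ g g' h) = 0} := by
      rintro h ⟨P, hP, hd, e1, e2, e3⟩
      have hPz : P = pt (P j, P l) := by
        funext v
        rcases hcov v with rfl | rfl | rfl
        · simp [pt, hij, hil, hP]
        · simp [pt]
        · simp [pt, hjl.symm]
      refine ⟨(P j, P l), hZ' _ _ ?_ ?_, ?_⟩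
      · rw [aevalAeval_dehom hcov hij hil hjl hP, e1]
      · rw [aevalAeval_dehom hcov hij hil hjl hP, e2]
      · rw [← hPz]
        exact ⟨hd, e3⟩
    refine (Nat.mul_le_mul_right _ (Nat.card_mono (Set.toFinite _) hsub')).trans ?_
    refine (card_exists_mul_le (c := 2) Z (fun z h => D * D < ptDegree F (pt z) ∧
      aeval (pt z) (S₃ g g' h) = 0) fun z _ => ?_).trans (by gcongr)
    by_cases hd : D * D < ptDegree F (pt z)
    · simp only [hd, true_and]
      exact card_aeval_eq_zero_mul_le p hcov (by simp [pt, hij, hil]) hd h27 (c + 1) _ _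
    · simp [hd]

end ChartBound

section HighDegree

omit [Fintype F] in
theorem SingAt.aeval_eq_zero {A B : MvPolynomial (Fin 3) F} {pt : Fin 3 → AlgebraicClosure F}
    (h : SingAt F A B pt) (h2 : (2 : F) ≠ 0) :
    (∀ v, aeval pt (C 3 * pderiv v B ^ 2 + A * pderiv v A ^ 2) = 0) ∧
      aeval pt (C 27 * B ^ 2 + 4 * A ^ 3) = 0 := by
  obtain ⟨x, y, h1, hy, hx, hd⟩ := h
  rw [mul_eq_zero, or_iff_right (two_ne_zero_closure h2)] at hy
  subst hy
  simp only [map_add, map_mul, map_pow, ← algebraMap_eq, map_ofNat]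
  refine ⟨fun v => ?_, ?_⟩
  · linear_combination aeval pt (pderiv v A) ^ 2 * hx +
      3 * (aeval pt (pderiv v B) - aeval pt (pderiv v A) * x) * hd v
  · have hA : aeval pt A = -3 * x ^ 2 := by linear_combination hx
    have hB : aeval pt B = 2 * x ^ 3 := by linear_combination -h1 - x * hA
    rw [hA, hB]
    ring

theorem wDensity_high_degree_le (p : ℕ) [Fact p.Prime] [CharP F p] (h2 : (2 : F) ≠ 0)
    (h3 : (3 : F) ≠ 0) {k : ℕ} (hk : p * p ≤ k) :
    wDensity F k (fun A B => ∃ P : Fin 3 → AlgebraicClosure F, IsNormalized P ∧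
      k < ptDegree F P ∧ SingAt F A B P) ≤
    3 * (4320050 * (((k.sqrt + 1 : ℕ) : ℝ) ^ 10 / (Fintype.card F : ℝ) ^ (k.sqrt + 1))) := by
  have hp : 0 < p := (Fact.out : p.Prime).pos
  set D := k.sqrt with hD
  have hpD : p ≤ D := Nat.le_sqrt.2 hk
  have hDk : D * D ≤ k := Nat.sqrt_le k
  have hkD : k ≤ (D + 1) ^ 2 := by
    have := Nat.lt_succ_sqrt k
    rw [sq]
    exact this.le
  have hDp : D * p ≤ k := (Nat.mul_le_mul_left D hpD).trans hDk
  have hk0 : 0 < k := (Nat.mul_pos hp hp).trans_le hk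
  have hq : 0 < (Fintype.card F : ℝ) := by exact_mod_cast Fintype.card_pos
  let E : Fin 3 → MvPolynomial (Fin 3) F → MvPolynomial (Fin 3) F → Prop := fun i A B =>
    ∃ pt : Fin 3 → AlgebraicClosure F, pt i = 1 ∧ D * D < ptDegree F pt ∧
      aeval pt (C 3 * pderiv (i + 1) B ^ 2 + A * pderiv (i + 1) A ^ 2) = 0 ∧
      aeval pt (C 3 * pderiv (i + 2) B ^ 2 + A * pderiv (i + 2) A ^ 2) = 0 ∧
      aeval pt (C 27 * B ^ 2 + 4 * A ^ 3) = 0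
  have hE : ∀ i, wDensity F k (E i) ≤
      4320050 * (((D + 1 : ℕ) : ℝ) ^ 10 / (Fintype.card F : ℝ) ^ (D + 1)) := by
    intro i
    have key := card_high_degree_chart_mul_le (F := F) (K := AlgebraicClosure F) p h3 (i := i)
      (j := i + 1) (l := i + 2) (by decide +revert) (by decide +revert) (by decide +revert)
      (by decide +revert) (k := k) (D := D) (c := 6 * k - D * p - 1) (by omega)
    have hM : 2 + (2 * (12 * k) * 2 + 2 * (12 * k) * ((2 * (12 * k) + 1) * (12 * k)) ^ 2 * 2) ≤
        4320050 * (D + 1) ^ 10 := by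
      have h1 : 1 ≤ (D + 1) ^ 2 := Nat.one_le_pow _ _ (Nat.succ_pos D)
      set n := (D + 1) ^ 2 with hn
      have : (D + 1) ^ 10 = n ^ 5 := by rw [hn]; ring
      rw [this]
      have h5 : n ≤ n ^ 5 := Nat.le_self_pow (by norm_num) n
      calc _ ≤ 2 * n + (2 * (12 * n) * 2 +
          2 * (12 * n) * ((2 * (12 * n) + n) * (12 * n)) ^ 2 * 2) := by
            gcongr
            omega
        _ = 50 * n + 4320000 * n ^ 5 := by ring
        _ ≤ _ := by omega
    rw [wDensity_eq, ← mul_div_assoc, div_le_div_iff₀ (by exact_mod_cast Nat.card_pos)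
        (by positivity)]
    exact_mod_cast key.trans (Nat.mul_le_mul_right _ hM)
  refine le_trans (wDensity_mono (Q' := fun A B => ∃ i ∈ Finset.univ, E i A B) ?_)
    ((wDensity_exists_le Finset.univ E).trans ((Finset.sum_le_card_nsmul _ _ _
        fun i _ => hE i).trans_eq
      (by simp)))
  rintro A B - - ⟨P, hP, hd, hs⟩
  obtain ⟨e1, e2⟩ := hs.aeval_eq_zero h2
  exact ⟨chart P, Finset.mem_univ _, P, hP, hDk.trans_lt hd, e1 _, e1 _, e2⟩

variable (F) in
theorem tendsto_sqrt_pow_div_pow :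
    Tendsto (fun k : ℕ => 3 * (4320050 * (((k.sqrt + 1 : ℕ) : ℝ) ^ 10 /
      (Fintype.card F : ℝ) ^ (k.sqrt + 1)))) atTop (nhds 0) := by
  have hq : 1 < (Fintype.card F : ℝ) := by exact_mod_cast Fintype.one_lt_card
  have hs : Tendsto (fun k : ℕ => k.sqrt + 1) atTop atTop :=
    tendsto_atTop_mono (fun k => Nat.le_succ _)
      (tendsto_atTop_atTop.2 fun b => ⟨b * b, fun a ha => Nat.le_sqrt.2 ha⟩)
  have :=
    (((tendsto_pow_const_div_const_pow_of_one_lt 10 hq).comp hs).const_mul 4320050).const_mul 3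
  simpa using this

end HighDegree

section EulerProduct

theorem hasSum_pnat_pow_div_log {x : ℝ} (h : |x| < 1) :
    HasSum (fun n : ℕ+ => x ^ (n : ℕ) / (n : ℕ)) (-Real.log (1 - x)) := by
  rw [← Equiv.pnatEquivNat.symm.hasSum_iff]
  convert Real.hasSum_pow_div_log_of_abs_lt_one h using 2 with n
  simp [Equiv.pnatEquivNat]

theorem hasSum_log_euler_product {q : ℝ} (hq : 1 < q) {b : ℕ → ℝ} (hb : ∀ n, 0 ≤ b n)
    (hsum : ∀ n ≠ 0, ∑ e ∈ n.divisors, b e = q ^ (2 * n) + q ^ n + 1) :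
    HasSum (fun n : ℕ => b (n + 1) / ((n + 1 : ℕ) : ℝ) * -Real.log (1 - (q ^ (3 * (n + 1)))⁻¹))
      (-Real.log (1 - q⁻¹) + -Real.log (1 - (q ^ 2)⁻¹) + -Real.log (1 - (q ^ 3)⁻¹)) := by
  have hq0 : 0 < q := one_pos.trans hq
  have habs : ∀ {n : ℕ}, n ≠ 0 → |(q ^ n)⁻¹| < 1 := fun {n} hn => by
    rw [abs_of_pos (by positivity)]
    exact inv_lt_one_of_one_lt₀ (one_lt_pow₀ hq hn)
  let f : ℕ+ × ℕ+ → ℝ := fun z =>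
    b z.1 * ((q ^ (3 * (z.1 * z.2 : ℕ)))⁻¹ / ((z.1 * z.2 : ℕ) : ℝ))
  have hf : ∀ z, 0 ≤ f z := fun z => mul_nonneg (hb _) (by positivity)
  have hfib : ∀ n : ℕ+, HasSum (fun d : (n : ℕ).divisorsAntidiagonal =>
      (f ∘ sigmaAntidiagonalEquivProd) ⟨n, d⟩)
      ((q⁻¹) ^ (n : ℕ) / (n : ℕ) + ((q ^ 2)⁻¹) ^ (n : ℕ) / (n : ℕ) +
        ((q ^ 3)⁻¹) ^ (n : ℕ) / (n : ℕ)) := by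
    intro n
    convert hasSum_fintype _ using 1
    have hterm : ∀ d : (n : ℕ).divisorsAntidiagonal, (f ∘ sigmaAntidiagonalEquivProd) ⟨n, d⟩ =
        b d.1.1 * ((q ^ (3 * (n : ℕ)))⁻¹ / (n : ℕ)) := by
      intro d
      have := (Nat.mem_divisorsAntidiagonal.1 d.2).1
      simp only [f, Function.comp_apply, sigmaAntidiagonalEquivProd, Equiv.coe_fn_mk,
        divisorsAntidiagonalFactors, PNat.mk_coe]
      rw [this]
    simp only [hterm]
    rw [← Finset.sum_mul]
    rw [Finset.univ_eq_attach, Finset.sum_attach (n : ℕ).divisorsAntidiagonal fun d => b d.1,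
      Nat.sum_divisorsAntidiagonal (fun i _ => b i), hsum n n.ne_zero]
    have h3 : q ^ (3 * (n : ℕ)) = q ^ (n : ℕ) * q ^ (2 * (n : ℕ)) := by rw [← pow_add]; ring_nf
    simp only [← inv_pow, ← pow_mul] at h3 ⊢
    rw [inv_pow, inv_pow, inv_pow, h3]
    have : 0 < q ^ (n : ℕ) := by positivity
    have : 0 < q ^ (2 * (n : ℕ)) := by positivity
    field_simp
  have hn : HasSum (fun n : ℕ+ => (q⁻¹) ^ (n : ℕ) / (n : ℕ) + ((q ^ 2)⁻¹) ^ (n : ℕ) / (n : ℕ) +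
      ((q ^ 3)⁻¹) ^ (n : ℕ) / (n : ℕ))
      (-Real.log (1 - q⁻¹) + -Real.log (1 - (q ^ 2)⁻¹) + -Real.log (1 - (q ^ 3)⁻¹)) :=
    ((hasSum_pnat_pow_div_log (by simpa using habs one_ne_zero)).add
      (hasSum_pnat_pow_div_log (habs two_ne_zero))).add
        (hasSum_pnat_pow_div_log (habs three_ne_zero))
  have hsig : Summable (f ∘ sigmaAntidiagonalEquivProd) := by
    refine (summable_sigma_of_nonneg fun z => hf (sigmaAntidiagonalEquivProd z)).2
      ⟨fun n => (hfib n).summable, ?_⟩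
    convert hn.summable using 2 with n
    exact (hfib n).tsum_eq
  have htot : HasSum f
      (-Real.log (1 - q⁻¹) + -Real.log (1 - (q ^ 2)⁻¹) + -Real.log (1 - (q ^ 3)⁻¹)) := by
    rw [← sigmaAntidiagonalEquivProd.hasSum_iff]
    have h := hsig.hasSum.sigma hfib
    rw [hn.unique h]
    exact hsig.hasSum
  have hg : ∀ e : ℕ+, HasSum (fun j => f (e, j))
      (b e / (e : ℕ) * -Real.log (1 - (q ^ (3 * (e : ℕ)))⁻¹)) := by
    intro e
    have h := (hasSum_pnat_pow_div_log (habs (n := 3 * (e : ℕ)) (by simp))).mul_left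
      (b e / (e : ℕ))
    have hfun : (fun j => f (e, j)) = fun j : ℕ+ => b e / (e : ℕ) *
        ((q ^ (3 * (e : ℕ)))⁻¹ ^ (j : ℕ) / (j : ℕ)) := by
      funext j
      simp only [f, Nat.cast_mul, inv_pow, ← pow_mul, mul_assoc]
      field_simp
    rw [hfun]
    exact h
  have := htot.prod_fiberwise hg
  rw [← Equiv.pnatEquivNat.symm.hasSum_iff] at this
  exact this

end EulerProduct

section OrbitRepresentatives

variable {K : Type*} [Field K] [Algebra F K]

variable (F) in
/-- A chosen representative of the Frobenius orbit of a point. -/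
def orbitRep (P : Fin 3 → K) : Fin 3 → K := Classical.epsilon fun Q => ∃ n, Q = (ptFrob F)^[n] P

omit [Field F] [Algebra F K] in
theorem exists_orbitRep_eq (P : Fin 3 → K) : ∃ n, orbitRep F P = (ptFrob F)^[n] P :=
  Classical.epsilon_spec (p := fun Q => ∃ n, Q = (ptFrob F)^[n] P) ⟨P, 0, rfl⟩

theorem exists_iterate_ptFrob_iterate_eq [Algebra.IsAlgebraic F K] (P : Fin 3 → K) (n : ℕ) :
    ∃ m, (ptFrob F)^[m] ((ptFrob F)^[n] P) = P := by
  refine ⟨n * (ptDegree F P - 1), ?_⟩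
  rw [← Function.iterate_add_apply]
  have : n * (ptDegree F P - 1) + n = ptDegree F P * n := by
    have := ptDegree_pos (F := F) P
    obtain ⟨d, hd⟩ := Nat.exists_eq_add_of_lt this
    rw [hd]; simp; ring
  rw [this, Function.iterate_mul]
  exact Function.iterate_fixed (iterate_ptDegree P) n

theorem orbitRep_iterate [Algebra.IsAlgebraic F K] (P : Fin 3 → K) (n : ℕ) :
    orbitRep F ((ptFrob F)^[n] P) = orbitRep F P := by
  unfold orbitRep
  congr 1
  funext Q
  refine propext ⟨?_, ?_⟩
  · rintro ⟨i, rfl⟩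
    exact ⟨i + n, by rw [Function.iterate_add_apply]⟩
  · rintro ⟨i, rfl⟩
    obtain ⟨m, hm⟩ := exists_iterate_ptFrob_iterate_eq (F := F) P n
    exact ⟨i + m, by rw [Function.iterate_add_apply, hm]⟩

theorem ptDegree_ptFrob_iterate [Algebra.IsAlgebraic F K] (P : Fin 3 → K) (n : ℕ) :
    ptDegree F ((ptFrob F)^[n] P) = ptDegree F P :=
  Function.minimalPeriod_apply_iterate
    (Function.mk_mem_periodicPts (ptDegree_pos P) (iterate_ptDegree P)) n

variable (F K) in
/-- Representatives of the Frobenius orbits of points of degree `e`. -/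
def orbitReps [IsAlgClosed K] [Algebra.IsAlgebraic F K] (e : ℕ) : Finset (Fin 3 → K) := by
  classical
  exact (finite_pointsOfDegree (F := F) (K := K) e).toFinset.image (orbitRep F)

variable [IsAlgClosed K] [Algebra.IsAlgebraic F K]

theorem mem_orbitReps {e : ℕ} {Q : Fin 3 → K} :
    Q ∈ orbitReps F K e ↔ Q ∈ pointsOfDegree F K e ∧ orbitRep F Q = Q := by
  classical
  simp only [orbitReps, Finset.mem_image, Set.Finite.mem_toFinset]
  constructor
  · rintro ⟨P, ⟨hP, hd⟩, rfl⟩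
    obtain ⟨n, hn⟩ := exists_orbitRep_eq (F := F) P
    rw [hn, orbitRep_iterate]
    exact ⟨⟨hP.ptFrob_iterate n, by rw [ptDegree_ptFrob_iterate, hd]⟩, hn⟩
  · rintro ⟨hQ, h⟩
    exact ⟨Q, hQ, h⟩

theorem mul_card_orbitReps (e : ℕ) :
    e * (orbitReps F K e).card = (pointsOfDegree F K e).ncard := by
  classical
  rw [Set.ncard_eq_toFinset_card _ (finite_pointsOfDegree e),
    Finset.card_eq_sum_card_fiberwise (f := orbitRep F) (t := orbitReps F K e)
      fun P hP => Finset.mem_image_of_mem _ hP, Finset.sum_const_nat fun Q hQ => ?_, mul_comm]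
  obtain ⟨⟨hnorm, rfl⟩, hrep⟩ := mem_orbitReps.1 hQ
  have : (finite_pointsOfDegree (F := F) (K := K) (ptDegree F Q)).toFinset.filter
      (fun P => orbitRep F P = Q) =
      (Finset.range (ptDegree F Q)).image fun n => (ptFrob F)^[n] Q := by
    ext P
    simp only [Finset.mem_filter, Set.Finite.mem_toFinset, Finset.mem_image, Finset.mem_range]
    constructor
    · rintro ⟨-, h⟩
      obtain ⟨n, hn⟩ := exists_orbitRep_eq (F := F) P
      obtain ⟨m, hm⟩ := exists_iterate_ptFrob_iterate_eq (F := F) P n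
      rw [← hn, h] at hm
      exact ⟨m % ptDegree F Q, Nat.mod_lt _ (ptDegree_pos Q), by
        rw [← hm]; exact Function.iterate_mod_minimalPeriod_eq⟩
    · rintro ⟨n, -, rfl⟩
      exact ⟨⟨hnorm.ptFrob_iterate n, ptDegree_ptFrob_iterate Q n⟩, by rw [orbitRep_iterate, hrep]⟩
  rw [this, Finset.card_image_of_injOn, Finset.card_range]
  intro i hi j hj h
  exact Function.iterate_injOn_Iio_minimalPeriod (Finset.mem_range.1 hi) (Finset.mem_range.1 hj) h

variable (F K) in
/-- Representatives of the Frobenius orbits of points of degree at most `r`. -/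
def orbitRepsUpTo (r : ℕ) : Finset (Fin 3 → K) := by
  classical
  exact (Finset.Icc 1 r).biUnion (orbitReps F K)

theorem mem_orbitRepsUpTo {r : ℕ} {Q : Fin 3 → K} :
    Q ∈ orbitRepsUpTo F K r ↔ IsNormalized Q ∧ ptDegree F Q ≤ r ∧ orbitRep F Q = Q := by
  classical
  simp only [orbitRepsUpTo, Finset.mem_biUnion, Finset.mem_Icc, mem_orbitReps]
  constructor
  · rintro ⟨e, ⟨-, he⟩, ⟨hQ, rfl⟩, h⟩
    exact ⟨hQ, he, h⟩
  · rintro ⟨hQ, hd, h⟩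
    exact ⟨_, ⟨ptDegree_pos Q, hd⟩, ⟨hQ, rfl⟩, h⟩

theorem orbitIndependent_orbitRepsUpTo (r : ℕ) : OrbitIndependent F (orbitRepsUpTo F K r) := by
  intro P hP Q hQ i j h
  rw [← (mem_orbitRepsUpTo.1 hP).2.2, ← (mem_orbitRepsUpTo.1 hQ).2.2, ← orbitRep_iterate P i, h,
    orbitRep_iterate]

theorem prod_orbitRepsUpTo (r : ℕ) (f : ℕ → ℝ) :
    ∏ P ∈ orbitRepsUpTo F K r, f (ptDegree F P) =
      ∏ e ∈ Finset.range r, f (e + 1) ^ (orbitReps F K (e + 1)).card := by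
  classical
  rw [orbitRepsUpTo, Finset.prod_biUnion]
  · rw [Finset.range_eq_Ico, Finset.prod_Ico_add' (fun e => f e ^ (orbitReps F K e).card), zero_add]
    refine Finset.prod_congr rfl fun e _ => Finset.prod_eq_pow_card fun P hP => ?_
    rw [(mem_orbitReps.1 hP).1.2]
  · intro a _ b _ hab
    rw [Function.onFun, Finset.disjoint_left]
    intro P hPa hPb
    exact hab ((mem_orbitReps.1 hPa).1.2.symm.trans (mem_orbitReps.1 hPb).1.2)

end OrbitRepresentatives

section Limit

variable (F) in
theorem tendsto_prod_orbitRepsUpTo :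
    Tendsto (fun r => ∏ P ∈ orbitRepsUpTo F (AlgebraicClosure F) r,
      (1 - ((Fintype.card F : ℝ) ^ (3 * ptDegree F P))⁻¹)) atTop
      (nhds ((1 - ((Fintype.card F : ℝ))⁻¹) * (1 - ((Fintype.card F : ℝ) ^ 2)⁻¹) *
        (1 - ((Fintype.card F : ℝ) ^ 3)⁻¹))) := by
  have hq : 1 < (Fintype.card F : ℝ) := by exact_mod_cast Fintype.one_lt_card
  have hpos : ∀ n ≠ 0, 0 < 1 - ((Fintype.card F : ℝ) ^ n)⁻¹ := fun n hn =>
    sub_pos.2 (inv_lt_one_of_one_lt₀ (one_lt_pow₀ hq hn))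
  have hlim := hasSum_log_euler_product hq
    (b := fun e => ((pointsOfDegree F (AlgebraicClosure F) e).ncard : ℝ)) (fun _ => by positivity)
    fun n hn => by exact_mod_cast sum_card_pointsOfDegree (F := F) (K := AlgebraicClosure F) hn
  have h := (Real.continuous_exp.tendsto _).comp hlim.tendsto_sum_nat.neg
  have h1 := hpos 1 one_ne_zero
  rw [pow_one] at h1
  convert h using 1
  · funext r
    rw [prod_orbitRepsUpTo r fun e => 1 - ((Fintype.card F : ℝ) ^ (3 * e))⁻¹, Function.comp_apply,
      ← Finset.sum_neg_distrib, Real.exp_sum]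
    refine Finset.prod_congr rfl fun e _ => ?_
    rw [← mul_card_orbitReps]
    push_cast
    rw [mul_div_cancel_left₀ _ (by positivity), mul_neg, neg_neg, Real.exp_nat_mul,
      Real.exp_log (hpos _ (by simp))]
  · rw [← neg_add, ← neg_add, neg_neg, Real.exp_add, Real.exp_add, Real.exp_log h1,
      Real.exp_log (hpos 2 two_ne_zero), Real.exp_log (hpos 3 three_ne_zero)]

variable {k : ℕ} {A B : MvPolynomial (Fin 3) F}

theorem SingAt.ptFrob_iterate (hA : A.IsHomogeneous (4 * k)) (hB : B.IsHomogeneous (6 * k))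
    (h2 : (2 : F) ≠ 0) {P : Fin 3 → AlgebraicClosure F} (hP : IsNormalized P)
    (h : SingAt F A B P) (n : ℕ) : SingAt F A B ((ptFrob F)^[n] P) := by
  rw [singAt_iff_singJet hA hB h2 hP] at h
  rw [singAt_iff_singJet hA hB h2 (hP.ptFrob_iterate n), chart_ptFrob_iterate]
  simp only [jet_ptFrob_iterate]
  obtain ⟨x, h1, h3, h4⟩ := h
  have hmap := fun z (hz : z = 0) => (congrArg (frobPow F (AlgebraicClosure F) n) hz).trans
    (map_zero _)
  refine ⟨frobPow F (AlgebraicClosure F) n x, ?_, ?_, fun j hj => ?_⟩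
  · simpa [map_ofNat (frobPow F (AlgebraicClosure F) n)] using hmap _ h1
  · simpa using hmap _ h3
  · simpa using hmap _ (h4 j hj)

theorem wDensity_smooth_le (h2 : (2 : F) ≠ 0) (h3 : (3 : F) ≠ 0) {r : ℕ}
    (hd : 2 * ∑ P ∈ orbitRepsUpTo F (AlgebraicClosure F) r, ptDegree F P ≤ 4 * k + 1) :
    wDensity F k (fun A B => ∀ pt : Fin 3 → AlgebraicClosure F, pt ≠ 0 → ¬ SingAt F A B pt) ≤
      ∏ P ∈ orbitRepsUpTo F (AlgebraicClosure F) r,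
        (1 - ((Fintype.card F : ℝ) ^ (3 * ptDegree F P))⁻¹) := by
  rw [← wDensity_forall_not_singAt h2 h3 (fun P hP => (mem_orbitRepsUpTo.1 hP).1)
    (orbitIndependent_orbitRepsUpTo r) hd]
  refine wDensity_mono fun A B _ _ h P hP => h P ?_
  rintro rfl
  exact zero_ne_one (mem_orbitRepsUpTo.1 hP).1

theorem le_wDensity_smooth_add (p : ℕ) [Fact p.Prime] [CharP F p] (h2 : (2 : F) ≠ 0)
    (h3 : (3 : F) ≠ 0) (hk : p * p ≤ k) {r : ℕ}
    (hd : 2 * ∑ P ∈ orbitRepsUpTo F (AlgebraicClosure F) r, ptDegree F P ≤ 4 * k + 1) :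
    ∏ P ∈ orbitRepsUpTo F (AlgebraicClosure F) r,
        (1 - ((Fintype.card F : ℝ) ^ (3 * ptDegree F P))⁻¹) ≤
      wDensity F k (fun A B => ∀ pt : Fin 3 → AlgebraicClosure F, pt ≠ 0 → ¬ SingAt F A B pt) +
      (∑ e ∈ Finset.Ioc r k, 3 * ((Fintype.card F : ℝ)⁻¹) ^ e +
        3 * (4320050 * (((k.sqrt + 1 : ℕ) : ℝ) ^ 10 / (Fintype.card F : ℝ) ^ (k.sqrt + 1)))) := by
  have hk0 : k ≠ 0 := by
    have := Nat.mul_pos (Fact.out : p.Prime).pos (Fact.out : p.Prime).pos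
    omega
  rw [← wDensity_forall_not_singAt h2 h3 (fun P hP => (mem_orbitRepsUpTo.1 hP).1)
    (orbitIndependent_orbitRepsUpTo r) hd]
  refine le_trans (wDensity_mono fun A B hA hB h => ?_) (wDensity_or_le.trans (add_le_add_right
    (wDensity_or_le.trans (add_le_add (wDensity_exists_singAt_le h2 h3 r k)
      (wDensity_high_degree_le p h2 h3 hk))) _))
  by_contra! hcon
  obtain ⟨hs, hmid, hhigh⟩ := hcon
  obtain ⟨P, hP, hsing⟩ := (exists_singAt_iff hA hB hk0).1 hs
  by_cases hr : ptDegree F P ≤ r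
  · obtain ⟨n, hn⟩ := exists_orbitRep_eq (F := F) P
    refine h _ (mem_orbitRepsUpTo.2 ⟨?_, ?_, ?_⟩) (hsing.ptFrob_iterate hA hB h2 hP n)
    · exact hP.ptFrob_iterate n
    · rwa [ptDegree_ptFrob_iterate]
    · rw [orbitRep_iterate, hn]
  · rcases le_or_gt (ptDegree F P) k with hPk | hPk
    · exact hmid P hP (not_le.1 hr) hPk hsing
    · exact hhigh P hP hPk hsing

theorem sum_Ioc_three_mul_inv_pow_le {q : ℝ} (hq : 1 < q) (r k : ℕ) :
    ∑ e ∈ Finset.Ioc r k, 3 * (q⁻¹) ^ e ≤ 3 * (q⁻¹ ^ r / (1 - q⁻¹)) := by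
  have h0 : 0 ≤ q⁻¹ := by positivity
  have h1 : q⁻¹ < 1 := inv_lt_one_of_one_lt₀ hq
  rw [← Finset.mul_sum]
  refine mul_le_mul_of_nonneg_left (le_trans ?_
    (geom_sum_Ico_le_of_lt_one (m := r) (n := k + 1) h0 h1)) (by norm_num)
  refine Finset.sum_le_sum_of_subset_of_nonneg (fun e he => ?_) fun _ _ _ => by positivity
  rw [Finset.mem_Ioc] at he
  exact Finset.mem_Ico.2 ⟨he.1.le, Nat.lt_succ_of_le he.2⟩

theorem tendsto_wDensity_smooth (p : ℕ) [Fact p.Prime] [CharP F p] (h2 : (2 : F) ≠ 0)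
    (h3 : (3 : F) ≠ 0) :
    Tendsto (fun k => wDensity F k
        (fun A B => ∀ pt : Fin 3 → AlgebraicClosure F, pt ≠ 0 → ¬ SingAt F A B pt)) atTop
      (nhds ((1 - ((Fintype.card F : ℝ))⁻¹) * (1 - ((Fintype.card F : ℝ) ^ 2)⁻¹) *
        (1 - ((Fintype.card F : ℝ) ^ 3)⁻¹))) := by
  have hq : 1 < (Fintype.card F : ℝ) := by exact_mod_cast Fintype.one_lt_card
  have htail : Tendsto (fun r : ℕ => 3 * ((Fintype.card F : ℝ)⁻¹ ^ r /
      (1 - (Fintype.card F : ℝ)⁻¹))) atTop (nhds 0) := by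
    simpa using ((tendsto_pow_atTop_nhds_zero_of_lt_one (r := (Fintype.card F : ℝ)⁻¹)
      (by positivity) (inv_lt_one_of_one_lt₀ hq)).div_const _).const_mul 3
  rw [Metric.tendsto_nhds]
  intro ε hε
  obtain ⟨r, hr1, hr2⟩ := ((Metric.tendsto_nhds.1 (tendsto_prod_orbitRepsUpTo F) (ε / 3)
    (by positivity)).and (htail.eventually_lt_const (show 0 < ε / 3 by positivity))).exists
  filter_upwards [(tendsto_sqrt_pow_div_pow F).eventually_lt_const (show 0 < ε / 3 by positivity),
    eventually_ge_atTop (p * p),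
    eventually_ge_atTop (∑ P ∈ orbitRepsUpTo F (AlgebraicClosure F) r, ptDegree F P)]
    with k h1 hp hd
  have hle := wDensity_smooth_le (k := k) (r := r) h2 h3 (by omega)
  have hge := le_wDensity_smooth_add (k := k) (r := r) p h2 h3 hp (by omega)
  have hsum := sum_Ioc_three_mul_inv_pow_le hq r k
  rw [Real.dist_eq, abs_lt] at hr1 ⊢
  constructor <;> linarith [hr1.1, hr1.2]

end Limit

variable (F)

/-- for `m = 2` the fraction of Weierstrass pairs of level `k` whose
model is singular over no point of `ℙ²(𝔽̄_q)` tends, as `k → ∞`, to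
`(1 − q⁻¹)(1 − q⁻²)(1 − q⁻³) = ζ_{ℙ²}(3)⁻¹`. -/
theorem stmt12 (p : ℕ) (hp : p.Prime) (hp3 : 3 < p) [CharP F p] :
    Tendsto (fun k : ℕ =>
        (Nat.card {AB ∈ WPairs F k | ∀ pt : Fin 3 → AlgebraicClosure F, pt ≠ 0 →
            ¬ SingAt F AB.1 AB.2 pt} : ℝ) / (Nat.card (WPairs F k) : ℝ))
      atTop
      (nhds ((1 - ((Fintype.card F : ℝ))⁻¹) * (1 - ((Fintype.card F : ℝ) ^ 2)⁻¹) *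
        (1 - ((Fintype.card F : ℝ) ^ 3)⁻¹))) := by
  have : Fact p.Prime := ⟨hp⟩
  have hne : ∀ n : ℕ, 0 < n → n < p → (n : F) ≠ 0 := fun n h0 hn h =>
    Nat.not_dvd_of_pos_of_lt h0 hn ((CharP.cast_eq_zero_iff F p n).1 h)
  exact tendsto_wDensity_smooth p (by exact_mod_cast hne 2 (by norm_num) (by omega))
    (by exact_mod_cast hne 3 (by norm_num) hp3)
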